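/- arXiv:1705.02597 — 7 statements merged into one kernel-verified Lean document; each statement's English description precedes it below -/
import Mathlib

section
/- For all integers x and all integers d ≥ 0, the alternating sum of the 2d+1 consecutive cubes starting at (x+1)³ satisfies the identity ∑_{i=1}^{2d+1} (−1)^{i−1} (x+i)³ = (x+d+1)·((x+d+1)² + 3d(d+1)). -/
/-- For all integers `x` and all integers `d ≥ 0`, the alternating sum of the `2d+1`
consecutive cubes starting at `(x+1)³` satisfies
`∑_{i=1}^{2d+1} (−1)^{i−1} (x+i)³ = (x+d+1)·((x+d+1)² + 3d(d+1))`. -/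
theorem alternating_cube_sum_odd_length (x : ℤ) (d : ℕ) :
    ∑ i ∈ Finset.range (2 * d + 1), (-1 : ℤ) ^ i * (x + (i : ℤ) + 1) ^ 3 =
      (x + d + 1) * ((x + d + 1) ^ 2 + 3 * d * (d + 1)) := by
  induction d with
  | zero => simp; ring
  | succ n ih =>
    rw [show 2 * (n + 1) + 1 = 2 * n + 1 + 1 + 1 by ring, Finset.sum_range_succ,
      Finset.sum_range_succ, ih]
    have h : (-1 : ℤ) ^ (2 * n) = 1 := by simp
    simp only [pow_succ (-1 : ℤ), h]
    push_cast
    ring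
end

section
/- Let d ≥ 1 be an integer, p a prime, and x, z integers with z ≠ 0 satisfying (x+d+1)·((x+d+1)² + 3d(d+1)) = z^p. Then there exist nonzero rational numbers α, β with αβ = 1, such that every prime dividing the numerator or the denominator of α divides 3d(d+1), and integers z₁, z₂ with z₁z₂ = z, such that x+d+1 = α·z₁^p and (x+d+1)² + 3d(d+1) = β·z₂^p; consequently β·z₂^p − α²·z₁^{2p} = 3d(d+1). -/
/-- The primes occurring in the fraction `a / b` divide `a` or `b`. -/
theorem Int.dvd_or_dvd_of_dvd_num_or_dvd_den {a b : ℤ} (hb : b ≠ 0) {q : ℕ}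
    (h : (q : ℤ) ∣ ((a : ℚ) / b).num ∨ q ∣ ((a : ℚ) / b).den) : (q : ℤ) ∣ a ∨ (q : ℤ) ∣ b := by
  rw [← Rat.divInt_eq_div] at h
  exact h.imp (fun h => h.trans (Rat.num_dvd a hb))
    (fun h => (Int.natCast_dvd_natCast.mpr h).trans (Rat.den_dvd a b))

/-- If `a * b = z ^ n` with `z ≠ 0`, then `z = u * v` where `a = α * u ^ n`, `b = α⁻¹ * v ^ n` and
every prime occurring in the rational number `α` divides both `a` and `b`. -/
theorem Int.exists_eq_mul_pow_of_mul_eq_pow {a b z : ℤ} {n : ℕ} (hn : n ≠ 0) (hz : z ≠ 0)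
    (h : a * b = z ^ n) :
    ∃ α : ℚ, α ≠ 0 ∧
      (∀ q : ℕ, q.Prime → ((q : ℤ) ∣ α.num ∨ q ∣ α.den) → (q : ℤ) ∣ a ∧ (q : ℤ) ∣ b) ∧
      ∃ u v : ℤ, u * v = z ∧ (a : ℚ) = α * (u : ℚ) ^ n ∧ (b : ℚ) = α⁻¹ * (v : ℚ) ^ n := by
  have hab : a * b ≠ 0 := h ▸ pow_ne_zero n hz
  have ha : a ≠ 0 := left_ne_zero_of_mul hab
  have hb : b ≠ 0 := right_ne_zero_of_mul hab
  obtain ⟨v, hv⟩ := Int.gcd_dvd_left z a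
  obtain ⟨c, hc⟩ := Int.gcd_dvd_right z a
  have hg : (Int.gcd z a : ℤ) ≠ 0 := fun h0 => hz (by rw [hv, h0, zero_mul])
  have hcop : IsCoprime v c := by
    rw [Int.isCoprime_iff_gcd_eq_one]
    have hgcd := Int.gcd_mul_left (Int.gcd z a : ℤ) v c
    rw [← hv, ← hc, Int.natAbs_natCast] at hgcd
    exact Nat.eq_of_mul_eq_mul_left (Nat.pos_of_ne_zero (by exact_mod_cast hg))
      (by rw [← hgcd, mul_one])
  generalize (Int.gcd z a : ℤ) = g at hv hc hg
  have hv0 : v ≠ 0 := fun h0 => hz (by rw [hv, h0, mul_zero])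
  have haQ : (a : ℚ) ≠ 0 := by exact_mod_cast ha
  have hbQ : (b : ℚ) ≠ 0 := by exact_mod_cast hb
  have hgQ : (g : ℚ) ≠ 0 := by exact_mod_cast hg
  have hvQ : (v : ℚ) ≠ 0 := by exact_mod_cast hv0
  have hQ : (a : ℚ) * b = (g : ℚ) ^ n * (v : ℚ) ^ n := by
    rw [← mul_pow]
    exact_mod_cast hv ▸ h
  have hα : (a : ℚ) / ((g ^ n : ℤ) : ℚ) = ((v ^ n : ℤ) : ℚ) / b := by
    push_cast
    rw [div_eq_div_iff (pow_ne_zero n hgQ) hbQ, hQ, mul_comm]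
  refine ⟨(a : ℚ) / ((g ^ n : ℤ) : ℚ), ?_, fun q hq hdvd => ?_, g, v, hv.symm, ?_, ?_⟩
  · push_cast
    exact div_ne_zero haQ (pow_ne_zero n hgQ)
  · have hqZ : Prime (q : ℤ) := Nat.prime_iff_prime_int.mp hq
    have hqa : (q : ℤ) ∣ a :=
      (Int.dvd_or_dvd_of_dvd_num_or_dvd_den (pow_ne_zero n hg) hdvd).elim id fun h =>
        (hqZ.dvd_of_dvd_pow h).trans ⟨c, hc⟩
    refine ⟨hqa, ?_⟩
    rw [hα] at hdvd
    refine (Int.dvd_or_dvd_of_dvd_num_or_dvd_den hb hdvd).elim (fun h' => ?_) id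
    have hqv : (q : ℤ) ∣ v := hqZ.dvd_of_dvd_pow h'
    have hcb : c * b = g ^ (n - 1) * v ^ n := by
      apply mul_left_cancel₀ hg
      rw [← mul_assoc, ← hc, h, ← mul_assoc, mul_pow_sub_one hn, ← mul_pow, ← hv]
    have hqcb : (q : ℤ) ∣ c * b := hcb ▸ h'.mul_left _
    exact (hqZ.dvd_or_dvd hqcb).resolve_left fun hqc =>
      hqZ.not_isUnit (hcop.isUnit_of_dvd' hqv hqc)
  · push_cast
    rw [div_mul_cancel₀ _ (pow_ne_zero n hgQ)]
  · rw [hα]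
    push_cast
    rw [inv_div, div_mul_cancel₀ _ (pow_ne_zero n hvQ)]


/-- Let `d ≥ 1`, `p` prime, and `x, z` integers with `z ≠ 0` satisfying
`(x+d+1)·((x+d+1)² + 3d(d+1)) = z^p`.  Then there exist nonzero rationals `α, β` with
`αβ = 1`, every prime dividing the numerator or denominator of `α` dividing `3d(d+1)`,
and integers `z₁, z₂` with `z₁z₂ = z`, `x+d+1 = α·z₁^p`,
`(x+d+1)² + 3d(d+1) = β·z₂^p`, and hence `β·z₂^p − α²·z₁^(2p) = 3d(d+1)`. -/
theorem factorization_of_alternating_cube_equation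
    (d : ℕ) (hd : 1 ≤ d) (p : ℕ) (hp : p.Prime) (x z : ℤ) (hz : z ≠ 0)
    (heq : (x + d + 1) * ((x + d + 1) ^ 2 + 3 * d * (d + 1)) = z ^ p) :
    ∃ α β : ℚ, α ≠ 0 ∧ β ≠ 0 ∧ α * β = 1 ∧
      (∀ q : ℕ, q.Prime → ((q : ℤ) ∣ α.num ∨ q ∣ α.den) → q ∣ 3 * d * (d + 1)) ∧
      ∃ z₁ z₂ : ℤ, z₁ * z₂ = z ∧
        ((x : ℚ) + d + 1 = α * (z₁ : ℚ) ^ p) ∧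
        (((x : ℚ) + d + 1) ^ 2 + 3 * d * (d + 1) = β * (z₂ : ℚ) ^ p) ∧
        (β * (z₂ : ℚ) ^ p - α ^ 2 * (z₁ : ℚ) ^ (2 * p) = 3 * d * (d + 1)) := by
  obtain ⟨α, hα, hprimes, z₁, z₂, hz₁₂, h₁, h₂⟩ :=
    Int.exists_eq_mul_pow_of_mul_eq_pow hp.ne_zero hz heq
  push_cast at h₁ h₂
  refine ⟨α, α⁻¹, hα, inv_ne_zero hα, mul_inv_cancel₀ hα, fun q hq hdvd => ?_,
    z₁, z₂, hz₁₂, h₁, h₂, ?_⟩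
  · obtain ⟨hqa, hqb⟩ := hprimes q hq hdvd
    have hsub := (dvd_add_right (hqa.trans (dvd_pow_self _ two_ne_zero))).mp hqb
    exact_mod_cast hsub
  · rw [← h₂, pow_mul', ← mul_pow, ← h₁]
    ring
end

section
/- Let d be an integer with 1 ≤ d ≤ 50, let p > 19 be a prime, and let (α, β) ∈ S_d. Suppose z₁, z₂ are integers with |z₁| ≥ 2, z₂ ≥ 2 and z₁² ≠ z₂ satisfying β·z₂^p − α²·z₁^{2p} = 3d(d+1). Set α₁ = β/α² and α₂ = z₁²/z₂. Then α₁ and α₂ are positive and multiplicatively independent (i.e. the only integers a, b with α₁^a = α₂^b are a = b = 0), and the linear form Λ = log α₁ − p·log α₂ satisfies 0 < Λ < 3d(d+1)/(α²·z₁^{2p}). -/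
/-- `S_d`: pairs `(α, β)` of positive rationals with `αβ = 1` such that every prime
dividing the numerator or denominator of `α` divides `3d(d+1)`. -/
def memSd (d : ℕ) (α β : ℚ) : Prop :=
  0 < α ∧ 0 < β ∧ α * β = 1 ∧
    ∀ q : ℕ, q.Prime → ((q : ℤ) ∣ α.num ∨ q ∣ α.den) → q ∣ 3 * d * (d + 1)

/-- If positive rationals `x, y` satisfy a nontrivial relation `x ^ a = y ^ b`, they are integral
powers of a common positive rational. -/
theorem exists_zpow_eq_and_zpow_eq {x y : ℚ} (hx : 0 < x) (hy : 0 < y) {a b : ℤ}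
    (hab : ¬(a = 0 ∧ b = 0)) (h : x ^ a = y ^ b) :
    ∃ t : ℚ, 0 < t ∧ ∃ m n : ℤ, x = t ^ m ∧ y = t ^ n := by
  have hg : 0 < Int.gcd a b := Int.gcd_pos_iff.2 (by tauto)
  obtain ⟨a', b', hcop, ha, hb⟩ := Int.exists_gcd_one hg
  have h' : x ^ a' = y ^ b' := by
    have h : x ^ (a' * (a.gcd b : ℤ)) = y ^ (b' * (a.gcd b : ℤ)) := by rw [← ha, ← hb, h]
    rw [zpow_mul, zpow_mul, zpow_natCast, zpow_natCast] at h
    exact (pow_left_inj₀ (zpow_pos hx _).le (zpow_pos hy _).le hg.ne').1 h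
  obtain ⟨r, s, hrs⟩ := Int.isCoprime_iff_gcd_eq_one.2 hcop
  refine ⟨x ^ s * y ^ r, by positivity, b', a', ?_, ?_⟩
  · rw [mul_zpow, ← zpow_mul, ← zpow_mul, mul_comm r b', zpow_mul y, ← h', ← zpow_mul,
      ← zpow_add₀ hx.ne', show s * b' + a' * r = 1 by linarith, zpow_one]
  · rw [mul_zpow, ← zpow_mul, ← zpow_mul, mul_comm s a', zpow_mul x, h', ← zpow_mul,
      ← zpow_add₀ hy.ne', show b' * s + r * a' = 1 by linarith, zpow_one]

/-- If `N * u ^ m * v ^ j` is an integral multiple of an integer `D` coprime to `u` and `v`, then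
`D` divides `N`, whatever the signs of the exponents. -/
theorem dvd_of_mul_eq_mul_zpow {X D N u v : ℤ} (hu : u ≠ 0) (hv : v ≠ 0)
    (hDu : IsCoprime D u) (hDv : IsCoprime D v) {m j : ℤ}
    (h : (X : ℚ) * D = N * (u : ℚ) ^ m * (v : ℚ) ^ j) : D ∣ N := by
  have key : ∀ (w : ℤ) (i : ℤ), w ≠ 0 →
      (w : ℚ) ^ i * (w : ℚ) ^ (-i).toNat = (w : ℚ) ^ i.toNat := by
    intro w i hw
    have hw' : (w : ℚ) ≠ 0 := by exact_mod_cast hw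
    rw [← zpow_natCast, ← zpow_natCast, ← zpow_add₀ hw']
    congr 1
    omega
  have h2 : X * D * u ^ (-m).toNat * v ^ (-j).toNat = N * (u ^ m.toNat * v ^ j.toNat) := by
    have : (X : ℚ) * D * (u : ℚ) ^ (-m).toNat * (v : ℚ) ^ (-j).toNat
        = N * ((u : ℚ) ^ m.toNat * (v : ℚ) ^ j.toNat) := by
      rw [h, ← key u m hu, ← key v j hv]
      ring
    exact_mod_cast this
  refine ((hDu.pow_right (n := m.toNat)).mul_right (hDv.pow_right (n := j.toNat))).dvd_of_dvd_mul_right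
    ⟨X * u ^ (-m).toNat * v ^ (-j).toNat, ?_⟩
  rw [← h2]
  ring

/-- The exponential equation `z₂ ^ p * (1 - t ^ (3 * m + p * n)) = N * t ^ m` with
`z = z₂ * t ^ n` has no solutions with `n ≠ 0` when `N` is small and `p` is large. -/
theorem false_of_common_base {N p : ℕ} (hN : 0 < N) (hN' : N ≤ 7650) (hp : 23 ≤ p)
    {t : ℚ} (ht : 0 < t) {m n : ℤ} (hn : n ≠ 0) {z w : ℤ} (hz : 2 ≤ z) (hw : 2 ≤ w)
    (hzw : (z : ℚ) = w * t ^ n) (hK : 0 < 3 * m + p * n)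
    (h : (w : ℚ) ^ p * (1 - t ^ (3 * m + p * n)) = N * t ^ m) : False := by
  obtain ⟨k, hk⟩ := Int.eq_ofNat_of_zero_le hK.le
  have hk0 : k ≠ 0 := by rintro rfl; simp at hk; omega
  rw [hk, zpow_natCast] at h
  have hw0 : (0 : ℚ) < w := by exact_mod_cast (by omega : 0 < w)
  have ht1 : t < 1 := by
    have h1 : 0 < (w : ℚ) ^ p * (1 - t ^ k) := by rw [h]; positivity
    have h2 : 0 < 1 - t ^ k := pos_of_mul_pos_right h1 (by positivity)
    exact (pow_lt_one_iff_of_nonneg ht.le hk0).1 (by linarith)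
  obtain ⟨u, v, hu, huv, hcop, rfl⟩ :
      ∃ u v : ℤ, 0 < u ∧ u < v ∧ IsCoprime u v ∧ t = (u : ℚ) / v := by
    refine ⟨t.num, t.den, Rat.num_pos.2 ht, ?_, ?_, (Rat.num_div_den t).symm⟩
    · rw [← Rat.num_div_den t, div_lt_one (by exact_mod_cast t.den_pos)] at ht1
      exact_mod_cast ht1
    · exact Rat.isCoprime_num_den t
  have hv : 0 < v := hu.trans huv
  have hu' : (0 : ℚ) < u := by exact_mod_cast hu
  have hv' : (0 : ℚ) < v := by exact_mod_cast hv
  set D : ℤ := v ^ k - u ^ k with hD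
  have hmain : (w : ℚ) ^ p * D = N * (u : ℚ) ^ m * (v : ℚ) ^ (k - m) := by
    have e : (w : ℚ) ^ p * D = (w : ℚ) ^ p * (1 - ((u : ℚ) / v) ^ k) * v ^ k := by
      rw [hD, div_pow]; push_cast; field_simp
    rw [e, h, div_zpow, zpow_sub₀ hv'.ne', zpow_natCast]
    field_simp
  have hDpos : 0 < D := sub_pos.2 (pow_lt_pow_left₀ huv hu.le hk0)
  have hDN : D ≤ N := by
    refine Int.le_of_dvd (by exact_mod_cast hN) (dvd_of_mul_eq_mul_zpow (X := w ^ p) (u := u)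
      (v := v) (m := m) (j := k - m) hu.ne' hv.ne' ?_ ?_ (by exact_mod_cast hmain))
    · have h1 : IsCoprime (v ^ k) u := hcop.symm.pow_left
      obtain ⟨c, hc⟩ := dvd_pow_self u hk0
      rw [hD, hc, sub_eq_add_neg, ← mul_neg]
      exact IsCoprime.add_mul_left_left h1 _
    · have h1 : IsCoprime (-u ^ k) v := hcop.pow_left.neg_left
      obtain ⟨c, hc⟩ := dvd_pow_self v hk0
      rw [hD, sub_eq_neg_add, hc]
      exact IsCoprime.add_mul_left_left h1 _
  have hNz : (N : ℤ) ≤ 7650 := by exact_mod_cast hN'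
  have hk10 : 2 ≤ u → k ≤ 10 := by
    intro hu2
    by_contra! hlt
    obtain ⟨i, rfl⟩ := Nat.exists_eq_add_of_le hlt
    have h1 : u ^ (10 + i) ≤ v ^ (10 + i) := pow_le_pow_left₀ hu.le huv.le _
    have h2 : v ^ (10 + i) ≤ D := by
      rw [hD, show 10 + 1 + i = (10 + i) + 1 by ring, pow_succ, pow_succ]
      nlinarith [pow_pos hv (10 + i)]
    have h3 : (3 : ℤ) ^ 10 ≤ v ^ (10 + i) :=
      (pow_le_pow_left₀ (by norm_num) (by omega) 10).trans
        (pow_le_pow_right₀ (by omega) (by omega))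
    norm_num at h3
    omega
  have hk12 : k ≤ 12 := by
    by_contra! hlt
    obtain rfl : u = 1 := by
      by_contra hu1
      have := hk10 (by omega)
      omega
    have h3 : (2 : ℤ) ^ 13 ≤ v ^ k :=
      (pow_le_pow_left₀ (by norm_num) (by omega) 13).trans
        (pow_le_pow_right₀ (by omega) (by omega))
    rw [one_pow] at hD
    norm_num at h3
    omega
  have hbig : ∀ g : ℤ, 2 ≤ g → (N : ℤ) < g ^ p := by
    intro g hg
    calc (N : ℤ) < 2 ^ 23 := by omega
      _ ≤ g ^ 23 := pow_le_pow_left₀ (by norm_num) hg 23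
      _ ≤ g ^ p := pow_le_pow_right₀ (by omega) hp
  have hsmall : ∀ g A : ℤ, 0 < g → 0 < A → g ^ p * A * D = N → g = 1 ∧ A ≤ 7650 := by
    intro g A hg hA hgA
    have hgp : 0 < g ^ p := pow_pos hg p
    have h1 : g ^ p * A ≤ N := by nlinarith [mul_pos hgp hA]
    refine ⟨?_, by nlinarith⟩
    by_contra hg1
    nlinarith [hbig g (by omega)]
  rcases lt_or_gt_of_ne hn with hneg | hpos
  · obtain ⟨l, rfl⟩ : ∃ l : ℕ, n = -l := ⟨(-n).toNat, by omega⟩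
    have hpl : p ≤ p * l := Nat.le_mul_of_pos_right p (by omega)
    have hk' : 3 * m - ((p * l : ℕ) : ℤ) = k := by rw [← hk]; push_cast; ring
    obtain ⟨j, hj⟩ : ∃ j : ℕ, m = k + j := ⟨(m - k).toNat, by omega⟩
    subst hj
    have hexp : p * l = (k + j) + (k + 2 * j) := by omega
    have hzw' : z * u ^ l = w * v ^ l := by
      rw [zpow_neg, zpow_natCast, div_pow] at hzw
      have : (z : ℚ) * u ^ l = w * v ^ l := by rw [hzw]; field_simp
      exact_mod_cast this
    obtain ⟨g, rfl⟩ : u ^ l ∣ w :=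
      (hcop.pow (m := l) (n := l)).dvd_of_dvd_mul_right ⟨z, by rw [← hzw']; ring⟩
    have hul : 0 < u ^ l := pow_pos hu l
    have hg : 0 < g := pos_of_mul_pos_right (by omega : 0 < u ^ l * g) hul.le
    have heq : g ^ p * (u ^ (k + 2 * j) * v ^ j) * D = N := by
      have h1 : (g : ℚ) ^ p * ((u : ℚ) ^ (k + 2 * j) * (v : ℚ) ^ j) * D = N := by
        have h2 : ((u : ℚ) ^ l) ^ p = (u : ℚ) ^ (k + j) * (u : ℚ) ^ (k + 2 * j) := by
          rw [← pow_mul, mul_comm l p, hexp, pow_add]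
        push_cast [mul_pow] at hmain
        rw [h2, show (k : ℤ) - (k + j) = -(j : ℤ) by ring, zpow_neg, zpow_natCast,
          show (k : ℤ) + j = ((k + j : ℕ) : ℤ) by push_cast; ring, zpow_natCast] at hmain
        field_simp at hmain
        linarith
      exact_mod_cast h1
    obtain ⟨rfl, hA⟩ := hsmall g _ hg (by positivity) heq
    have hu2 : 2 ≤ u := by
      by_contra hu1
      obtain rfl : u = 1 := by omega
      simp at hw
    have := hk10 hu2
    have h12 : (2 : ℤ) ^ 12 ≤ u ^ (k + 2 * j) :=
      (pow_le_pow_left₀ (by norm_num) hu2 12).trans (pow_le_pow_right₀ (by omega) (by omega))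
    have h3 : (3 : ℤ) ^ 1 ≤ v ^ j :=
      (pow_le_pow_left₀ (by norm_num) (by omega) 1).trans
        (pow_le_pow_right₀ (by omega) (by omega))
    norm_num at h12 h3
    nlinarith
  · obtain ⟨l, rfl⟩ : ∃ l : ℕ, n = l := ⟨n.toNat, by omega⟩
    have hpl : p ≤ p * l := Nat.le_mul_of_pos_right p (by omega)
    have hk' : 3 * m + ((p * l : ℕ) : ℤ) = k := by rw [← hk]; push_cast; ring
    obtain ⟨j, rfl⟩ : ∃ j : ℕ, m = -j := ⟨(-m).toNat, by omega⟩
    have hexp : p * l = (k + j) + 2 * j := by omega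
    have hzw' : z * v ^ l = w * u ^ l := by
      rw [zpow_natCast, div_pow] at hzw
      have : (z : ℚ) * v ^ l = w * u ^ l := by rw [hzw]; field_simp
      exact_mod_cast this
    obtain ⟨g, rfl⟩ : v ^ l ∣ w :=
      (hcop.symm.pow (m := l) (n := l)).dvd_of_dvd_mul_right ⟨z, by rw [← hzw']; ring⟩
    have hvl : 0 < v ^ l := pow_pos hv l
    have hg : 0 < g := pos_of_mul_pos_right (by omega : 0 < v ^ l * g) hvl.le
    have hzg : z = g * u ^ l := mul_right_cancel₀ hvl.ne' (by rw [hzw']; ring)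
    have heq : g ^ p * (v ^ (2 * j) * u ^ j) * D = N := by
      have h1 : (g : ℚ) ^ p * ((v : ℚ) ^ (2 * j) * (u : ℚ) ^ j) * D = N := by
        have h2 : ((v : ℚ) ^ l) ^ p = (v : ℚ) ^ (k + j) * (v : ℚ) ^ (2 * j) := by
          rw [← pow_mul, mul_comm l p, hexp, pow_add]
        push_cast [mul_pow] at hmain
        rw [h2, zpow_neg, zpow_natCast,
          show (k : ℤ) - -j = ((k + j : ℕ) : ℤ) by push_cast; ring, zpow_natCast] at hmain
        field_simp at hmain
        linarith
      exact_mod_cast h1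
    obtain ⟨rfl, hA⟩ := hsmall g _ hg (by positivity) heq
    have hu2 : 2 ≤ u := by
      by_contra hu1
      obtain rfl : u = 1 := by omega
      simp at hzg
      omega
    have h8 : (3 : ℤ) ^ 8 ≤ v ^ (2 * j) :=
      (pow_le_pow_left₀ (by norm_num) (by omega) 8).trans
        (pow_le_pow_right₀ (by omega) (by omega))
    have h4 : (2 : ℤ) ^ 4 ≤ u ^ j :=
      (pow_le_pow_left₀ (by norm_num) hu2 4).trans (pow_le_pow_right₀ (by omega) (by omega))
    norm_num at h8 h4
    nlinarith

/-- Let `1 ≤ d ≤ 50`, `p > 19` prime, `(α, β) ∈ S_d`, and `z₁, z₂` integers with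
`|z₁| ≥ 2`, `z₂ ≥ 2`, `z₁² ≠ z₂` and `β·z₂^p − α²·z₁^{2p} = 3d(d+1)`.  With
`α₁ = β/α²` and `α₂ = z₁²/z₂`, the numbers `α₁, α₂` are positive and multiplicatively
independent, and `Λ = log α₁ − p·log α₂` satisfies `0 < Λ < 3d(d+1)/(α²·z₁^{2p})`. -/
theorem linear_form_bounds (d : ℕ) (hd1 : 1 ≤ d) (hd2 : d ≤ 50)
    (p : ℕ) (hp : p.Prime) (hp19 : 19 < p)
    (α β : ℚ) (hS : memSd d α β) (z₁ z₂ : ℤ) (hz1 : 2 ≤ |z₁|) (hz2 : 2 ≤ z₂)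
    (hne : z₁ ^ 2 ≠ z₂)
    (heq : β * (z₂ : ℚ) ^ p - α ^ 2 * (z₁ : ℚ) ^ (2 * p) = 3 * d * (d + 1)) :
    0 < β / α ^ 2 ∧ 0 < (z₁ : ℚ) ^ 2 / (z₂ : ℚ) ∧
    (∀ a b : ℤ, (β / α ^ 2) ^ a = ((z₁ : ℚ) ^ 2 / (z₂ : ℚ)) ^ b → a = 0 ∧ b = 0) ∧
    (0 < Real.log ((β : ℝ) / (α : ℝ) ^ 2) -
        p * Real.log (((z₁ : ℝ)) ^ 2 / (z₂ : ℝ)) ∧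
      Real.log ((β : ℝ) / (α : ℝ) ^ 2) -
          p * Real.log (((z₁ : ℝ)) ^ 2 / (z₂ : ℝ)) <
        3 * d * (d + 1) / ((α : ℝ) ^ 2 * (z₁ : ℝ) ^ (2 * p))) := by
  obtain ⟨hα, hβ, hαβ, -⟩ := hS
  have hz1sq : 4 ≤ z₁ ^ 2 := by rw [← sq_abs]; nlinarith
  have hz1ne : z₁ ≠ 0 := by rintro rfl; norm_num at hz1sq
  have hz1q : (z₁ : ℚ) ≠ 0 := by exact_mod_cast hz1ne
  have hz2q : (0 : ℚ) < z₂ := by exact_mod_cast (by omega : 0 < z₂)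
  have hβα : β = α⁻¹ := eq_inv_of_mul_eq_one_right hαβ
  have hy : 0 < (z₁ : ℚ) ^ 2 / (z₂ : ℚ) := by positivity
  refine ⟨by positivity, hy, ?_, ?_⟩
  · intro a b hab
    by_contra hab0
    have hab' : α ^ (-3 * a) = ((z₁ : ℚ) ^ 2 / (z₂ : ℚ)) ^ b := by
      rw [← hab, hβα, zpow_mul]
      congr 1
      rw [zpow_neg]
      norm_cast
      field_simp
    obtain ⟨t, ht, m, n, hm, hn⟩ :=
      exists_zpow_eq_and_zpow_eq hα hy (by omega) hab'
    have hz : ((z₁ ^ 2 : ℤ) : ℚ) = z₂ * t ^ n := by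
      rw [← hn]; push_cast; field_simp
    have hn0 : n ≠ 0 := by
      rintro rfl
      apply hne
      rw [zpow_zero, mul_one] at hz
      exact_mod_cast hz
    have hN : 0 < 3 * d * (d + 1) := by positivity
    have hN' : 3 * d * (d + 1) ≤ 7650 := by nlinarith
    have hp23 : 23 ≤ p := by
      by_contra! hlt
      interval_cases p <;> revert hp <;> norm_num
    have hmain : (z₂ : ℚ) ^ p * (1 - t ^ (3 * m + p * n)) = (3 * d * (d + 1) : ℕ) * t ^ m := by
      have h1 : t ^ (3 * m + p * n) = α ^ 3 * ((z₁ : ℚ) ^ 2 / z₂) ^ p := by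
        rw [zpow_add₀ ht.ne', mul_comm 3 m, mul_comm (p : ℤ) n, zpow_mul, zpow_mul, ← hm, ← hn]
        norm_cast
      rw [h1, ← hm]
      push_cast
      rw [← heq, hβα, div_pow, ← pow_mul]
      field_simp
    rcases lt_trichotomy (3 * m + p * n) 0 with hK | hK | hK
    · have hneg : (3 * -m + p * -n : ℤ) = -(3 * m + p * n) := by ring
      refine false_of_common_base (z := z₁ ^ 2) (t := t⁻¹) (m := -m) (n := -n) hN hN' hp23 (inv_pos.2 ht)
        (by omega) (by omega) hz2 ?_ (by omega) ?_
      · rw [inv_zpow', neg_neg]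
        exact hz
      · simp only [inv_zpow', hneg, neg_neg]
        exact hmain
    · rw [hK] at hmain
      have : 0 < ((3 * d * (d + 1) : ℕ) : ℚ) * t ^ m := by positivity
      rw [← hmain] at this
      simp at this
    · exact false_of_common_base (z := z₁ ^ 2) hN hN' hp23 ht hn0 (by omega) hz2 hz hK hmain
  · have hαr : (0 : ℝ) < α := by exact_mod_cast hα
    have hβr : (0 : ℝ) < β := by exact_mod_cast hβ
    have hz1r : (z₁ : ℝ) ≠ 0 := by exact_mod_cast hz1ne
    have hz2r : (0 : ℝ) < z₂ := by exact_mod_cast hz2q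
    have heqr : (β : ℝ) * (z₂ : ℝ) ^ p - (α : ℝ) ^ 2 * (z₁ : ℝ) ^ (2 * p) = 3 * d * (d + 1) := by
      exact_mod_cast heq
    have hz1p : (0 : ℝ) < (z₁ : ℝ) ^ (2 * p) := by rw [pow_mul]; positivity
    have hdr : (0 : ℝ) < 3 * d * (d + 1) := by positivity
    set x : ℝ := 3 * d * (d + 1) / ((α : ℝ) ^ 2 * (z₁ : ℝ) ^ (2 * p)) with hx
    have hxpos : 0 < x := by positivity
    have hΛ : Real.log ((β : ℝ) / (α : ℝ) ^ 2) - p * Real.log (((z₁ : ℝ)) ^ 2 / (z₂ : ℝ)) =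
        Real.log (1 + x) := by
      rw [← Real.log_pow, ← Real.log_div (by positivity) (by positivity)]
      congr 1
      rw [hx, ← heqr, div_pow, ← pow_mul]
      field_simp
      ring
    rw [hΛ]
    refine ⟨Real.log_pos (by linarith), ?_⟩
    have := Real.log_lt_sub_one_of_pos (x := 1 + x) (by linarith) (by linarith)
    linarith
end

section
/- Let d be an integer with 1 ≤ d ≤ 50, let p be a prime, and let (α, β) ∈ S_d. Suppose z₁, z₂ are integers with |z₁| ≥ 2, z₂ ≥ 2 and z₁² ≠ z₂ satisfying β·z₂^p − α²·z₁^{2p} = 3d(d+1). Then p < 4·10⁴. -/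
theorem exists_coprime_split (y : ℕ) (g : ℕ) (hg : g ≠ 0) :
    ∃ g₁ g₂ n : ℕ, g = g₁ * g₂ ∧ g₁.Coprime y ∧ g₂ ∣ y ^ n := by
  induction g using Nat.strong_induction_on with
  | _ g ih =>
    by_cases hc : g.Coprime y
    · exact ⟨g, 1, 0, by simp, hc, by simp⟩
    · have hk0 : g.gcd y ≠ 0 := Nat.gcd_ne_zero_left hg
      obtain ⟨g', hg'⟩ := Nat.gcd_dvd_left g y
      have h_ne : g' ≠ 0 := by rintro rfl; simp at hg'; exact hg hg'
      have hk1 : 1 < g.gcd y := by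
        have : g.gcd y ≠ 1 := hc
        omega
      have hlt : g' < g := by
        conv_rhs => rw [hg']
        exact lt_mul_of_one_lt_left (Nat.pos_of_ne_zero h_ne) hk1
      obtain ⟨g₁, g₂, n, h1, h2, h3⟩ := ih g' hlt h_ne
      refine ⟨g₁, g.gcd y * g₂, n + 1, ?_, h2, ?_⟩
      · rw [h1] at hg'
        rw [mul_left_comm]
        exact hg'
      · rw [pow_succ']
        exact mul_dvd_mul (Nat.gcd_dvd_right g y) h3

theorem exists_pow_split {Y N w p : ℕ} (hY : 0 < Y) (hN : 0 < N)
    (h : Y * (Y ^ 2 + N) = w ^ p) :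
    ∃ g₁ g₂ z₁ z₂ : ℕ, 0 < g₁ ∧ 0 < g₂ ∧ g₁ * g₂ ≤ N ∧ Y * g₂ = g₁ * z₁ ^ p ∧
      (Y ^ 2 + N) * g₁ = g₂ * z₂ ^ p := by
  obtain ⟨g, y, t, hg, hyt, hYg, hxg⟩ := Nat.exists_coprime' (m := Y) (n := Y ^ 2 + N)
    (Nat.gcd_pos_of_pos_left _ hY)
  have hgN : g ∣ N := by
    have h1 : g ∣ Y := ⟨y, by rw [hYg]; ring⟩
    have h2 : g ∣ Y ^ 2 + N := ⟨t, by rw [hxg]; ring⟩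
    exact (Nat.dvd_add_right (h1.trans (dvd_pow_self Y two_ne_zero))).mp h2
  obtain ⟨g₁, g₂, n, rfl, h1, h2⟩ := exists_coprime_split y g hg.ne'
  have hg1 : 0 < g₁ := Nat.pos_of_mul_pos_right hg
  have hg2 : 0 < g₂ := Nat.pos_of_mul_pos_left hg
  have c12 : g₁.Coprime g₂ := (h1.pow_right n).coprime_dvd_right h2
  have ct2 : t.Coprime g₂ := (hyt.symm.pow_right n).coprime_dvd_right h2
  have hc : (g₂ ^ 2 * y).Coprime (g₁ ^ 2 * t) := by
    refine Nat.Coprime.mul_left (Nat.Coprime.pow_left 2 ?_) ?_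
    · exact Nat.Coprime.mul_right (Nat.Coprime.pow_right 2 c12.symm) ct2.symm
    · exact Nat.Coprime.mul_right (Nat.Coprime.pow_right 2 h1.symm) hyt
  have hmul : (g₂ ^ 2 * y) * (g₁ ^ 2 * t) = w ^ p := by
    rw [← h, hxg]; conv_rhs => rw [hYg]
    ring
  obtain ⟨z₁, hz1⟩ := exists_eq_pow_of_mul_eq_pow (Nat.isUnit_iff.2 hc) hmul
  obtain ⟨z₂, hz2⟩ := exists_eq_pow_of_mul_eq_pow (Nat.isUnit_iff.2 hc.symm)
    ((mul_comm _ _).trans hmul)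
  refine ⟨g₁, g₂, z₁, z₂, hg1, hg2, Nat.le_of_dvd hN hgN, ?_, ?_⟩
  · rw [← hz1, hYg]; ring
  · rw [← hz2, hxg]; ring

theorem exists_nat_eq_of_mul_sq_add {r : ℚ} (hr : 0 < r) {N : ℕ} {n : ℕ}
    (h : r * (r ^ 2 + N) = n) : ∃ Y : ℕ, r = Y := by
  have h_int : IsIntegral ℤ r := by
    refine ⟨Polynomial.X ^ 3 + (Polynomial.C (N : ℤ) * Polynomial.X + Polynomial.C (-n : ℤ)), ?_, ?_⟩
    · refine Polynomial.monic_X_pow_add (lt_of_le_of_lt Polynomial.degree_linear_le ?_)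
      norm_num
    · simp
      linarith
  obtain ⟨k, hk⟩ := IsIntegrallyClosed.isIntegral_iff.mp h_int
  simp at hk
  have hk0 : 0 ≤ k := by
    have : (0 : ℚ) < k := by rw [hk]; exact hr
    exact_mod_cast this.le
  obtain ⟨m, rfl⟩ := Int.eq_ofNat_of_zero_le hk0
  exact ⟨m, by rw [← hk]; simp⟩

open Polynomial in
theorem natDegree_comp_X_add_C_and_coeff (q : ℝ[X]) (c : ℝ) :
    (q.comp (X + C c)).natDegree = q.natDegree ∧
      (q.comp (X + C c)).coeff q.natDegree = q.leadingCoeff := by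
  have h1 : (q.comp (X + C c)).natDegree = q.natDegree := by simp [natDegree_comp]
  refine ⟨h1, ?_⟩
  conv_lhs => rw [← h1]
  rw [coeff_natDegree, leadingCoeff_comp (by simp)]
  simp

open Polynomial in
theorem natDegree_shift_mul_C_le (q : ℝ[X]) (c e : ℝ) :
    (q.comp (X + C c) * C e).natDegree ≤ q.natDegree :=
  (natDegree_mul_C_le _ _).trans (natDegree_comp_X_add_C_and_coeff q c).1.le

open Polynomial in
theorem det_shift_ne_zero (q : Fin 3 → ℝ[X]) (hq : ∀ l, q l ≠ 0) {a : ℝ} (ha : 0 < a)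
    (ha1 : a ≠ 1) :
    (Matrix.of fun i l : Fin 3 => (q l).comp (X + C (3 * ((i : ℕ) : ℝ))) *
      C ((a ^ (l : ℕ)) ^ (i : ℕ))).det ≠ 0 := by
  intro h0
  have key : (Matrix.of fun i l : Fin 3 => (q l).comp (X + C (3 * ((i : ℕ) : ℝ))) *
      C ((a ^ (l : ℕ)) ^ (i : ℕ))).det.coeff (∑ l, (q l).natDegree) =
      (∏ l, (q l).leadingCoeff) * (Matrix.vandermonde fun l : Fin 3 => a ^ (l : ℕ)).det := by
    rw [Matrix.det_apply, Matrix.det_apply, finsetSum_coeff, Finset.mul_sum]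
    refine Finset.sum_congr rfl fun σ _ => ?_
    rw [Units.smul_def, Units.smul_def, coeff_smul, mul_smul_comm]
    congr 1
    simp only [Matrix.of_apply, Matrix.vandermonde_apply]
    rw [Fin.sum_univ_three, Fin.prod_univ_three, Fin.prod_univ_three, Fin.prod_univ_three,
      coeff_mul_add_eq_of_natDegree_le _ (natDegree_shift_mul_C_le _ _ _),
      coeff_mul_add_eq_of_natDegree_le (natDegree_shift_mul_C_le _ _ _)
        (natDegree_shift_mul_C_le _ _ _)]
    · simp only [coeff_mul_C, (natDegree_comp_X_add_C_and_coeff _ _).2]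
      rw [pow_right_comm, pow_right_comm a _ ((1 : Fin 3) : ℕ),
        pow_right_comm a _ ((2 : Fin 3) : ℕ)]
      ring
    · exact natDegree_mul_le.trans
        (add_le_add (natDegree_shift_mul_C_le _ _ _) (natDegree_shift_mul_C_le _ _ _))
  rw [h0, coeff_zero] at key
  refine mul_ne_zero (Finset.prod_ne_zero_iff.2 fun l _ => leadingCoeff_ne_zero.2 (hq l)) ?_ key.symm
  rw [Matrix.det_vandermonde_ne_zero_iff]
  intro i j hij
  exact Fin.ext (pow_right_injective₀ ha ha1 hij)

theorem grid_injective {p R S : ℕ} (hR : 3 * R ≤ p) (x₀ : ℝ) :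
    Function.Injective fun n : Fin R × Fin S =>
      3 * ((n.1 : ℕ) : ℝ) + p * ((n.2 : ℕ) : ℝ) - x₀ := by
  rintro ⟨r, s⟩ ⟨r', s'⟩ h
  have h' : 3 * (r : ℕ) + p * (s : ℕ) = 3 * (r' : ℕ) + p * (s' : ℕ) := by
    have : 3 * ((r : ℕ) : ℝ) + p * ((s : ℕ) : ℝ) = 3 * ((r' : ℕ) : ℝ) + p * ((s' : ℕ) : ℝ) := by
      simpa using h
    exact_mod_cast this
  have hr := r.2
  have hr' := r'.2
  have hp : 0 < p := by omega
  have hs : (s : ℕ) = s' := by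
    have := congrArg (· / p) h'
    simpa [Nat.add_mul_div_left _ _ hp, Nat.div_eq_of_lt (show 3 * (r : ℕ) < p by omega),
      Nat.div_eq_of_lt (show 3 * (r' : ℕ) < p by omega)] using this
  rw [hs] at h'
  ext <;> simp <;> omega

open Polynomial in
/-- Zero estimate on a grid. -/
theorem eq_zero_of_grid_relation {p R S K : ℕ} (hR : 3 * R ≤ p) (hcard : 3 * K ≤ (R - 2) * S)
    (hK : 0 < K) {a b : ℝ} (ha : 0 < a) (ha1 : a ≠ 1) (hb : 0 < b) (x₀ : ℝ) (q : Fin 3 → ℝ[X])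
    (hdeg : ∀ l, (q l).natDegree < K)
    (hrel : ∀ (r : Fin R) (s : Fin S), ∑ l, (q l).eval (3 * ((r : ℕ) : ℝ) + p * ((s : ℕ) : ℝ) - x₀) *
      (a ^ (r : ℕ) * b ^ (s : ℕ)) ^ (l : ℕ) = 0) : ∀ l, q l = 0 := by
  classical
  by_contra! hne
  obtain ⟨l₀, hl₀⟩ := hne
  set q' : Fin 3 → ℝ[X] := fun l => if q l = 0 then 1 else q l with hq'
  have hq'ne : ∀ l, q' l ≠ 0 := by
    intro l; simp only [hq']; split_ifs with h
    · exact one_ne_zero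
    · exact h
  have hq'deg : ∀ l, (q' l).natDegree ≤ K - 1 := by
    intro l; simp only [hq']; split_ifs with h
    · simp
    · have := hdeg l; omega
  refine det_shift_ne_zero q' hq'ne ha ha1 ?_
  refine eq_zero_of_natDegree_lt_card_of_eval_eq_zero _
    (grid_injective (p := p) (R := R - 2) (S := S) (by omega) x₀) ?_ ?_
  · rintro ⟨r, s⟩
    rw [← coe_evalRingHom, RingHom.map_det, ← Matrix.exists_mulVec_eq_zero_iff]
    set y : ℝ := a ^ (r : ℕ) * b ^ (s : ℕ) with hy
    have hy0 : 0 < y := by positivity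
    refine ⟨fun l => if q l = 0 then 0 else y ^ (l : ℕ), fun h => ?_, ?_⟩
    · have := congrFun h l₀
      simp [hl₀] at this
      exact hy0.ne' this.1
    · ext i
      have hr := r.2
      have hrel' := hrel ⟨r + i, by omega⟩ s
      rw [Pi.zero_apply, Matrix.mulVec, dotProduct]
      refine Eq.trans ?_ hrel'
      refine Finset.sum_congr rfl fun l _ => ?_
      by_cases hl : q l = 0
      · simp [hl]
      · have hpow : (a ^ (l : ℕ)) ^ (i : ℕ) * y ^ (l : ℕ) =
            (a ^ ((r : ℕ) + i) * b ^ (s : ℕ)) ^ (l : ℕ) := by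
          rw [hy]; ring
        have harg : 3 * ((r : ℕ) : ℝ) + p * ((s : ℕ) : ℝ) - x₀ + 3 * ((i : ℕ) : ℝ) =
            3 * (((r : ℕ) + i : ℕ) : ℝ) + p * ((s : ℕ) : ℝ) - x₀ := by
          push_cast; ring
        simp only [RingHom.mapMatrix_apply, Matrix.map_apply, Matrix.of_apply, coe_evalRingHom,
          eval_mul, eval_comp, eval_add, eval_X, eval_C, hq', if_neg hl]
        rw [mul_assoc, hpow, harg]
  · rw [Fintype.card_prod, Fintype.card_fin, Fintype.card_fin]
    refine lt_of_le_of_lt (b := 3 * (K - 1)) ?_ (by omega)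
    rw [Matrix.det_apply]
    refine natDegree_sum_le_of_forall_le _ _ fun σ _ => ?_
    refine (natDegree_smul_le _ _).trans ((natDegree_prod_le _ _).trans ?_)
    refine (Finset.sum_le_card_nsmul _ _ (K - 1) fun l _ => ?_).trans (by simp)
    exact (natDegree_shift_mul_C_le _ _ _).trans (hq'deg l)
/-- A matrix with independent rows has a nonzero maximal minor. -/
theorem exists_det_submatrix_ne_zero {ι ν : Type*} [Fintype ι] [DecidableEq ι] [Fintype ν]
    (F : Matrix ι ν ℝ) (hF : LinearIndependent ℝ F.row) :
    ∃ J : ι → ν, (F.submatrix id J).det ≠ 0 := by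
  obtain ⟨κ, f, -, hspan, hli⟩ := exists_linearIndependent' ℝ F.col
  have hrank := hF.rank_matrix
  rw [Matrix.rank_eq_finrank_span_cols, ← hspan] at hrank
  have : Finite κ := hli.finite
  have := Fintype.ofFinite κ
  rw [finrank_span_eq_card hli] at hrank
  let e : ι ≃ κ := Fintype.equivOfCardEq hrank.symm
  refine ⟨f ∘ e, ?_⟩
  rw [← isUnit_iff_ne_zero, ← Matrix.isUnit_iff_isUnit_det,
    ← Matrix.linearIndependent_cols_iff_isUnit]
  exact hli.comp e e.injective

open Polynomial in
open scoped Nat in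
theorem exists_grid_det_ne_zero {p R S K : ℕ} (hR : 3 * R ≤ p) (hcard : 3 * K ≤ (R - 2) * S)
    (hK : 0 < K) {a b : ℝ} (ha : 0 < a) (ha1 : a ≠ 1) (hb : 0 < b) (x₀ : ℝ) :
    ∃ J : Fin K × Fin 3 → Fin R × Fin S, (Matrix.of fun i j : Fin K × Fin 3 =>
      (3 * (((J j).1 : ℕ) : ℝ) + p * (((J j).2 : ℕ) : ℝ) - x₀) ^ (i.1 : ℕ) / ((i.1 : ℕ)! : ℝ) *
        (a ^ ((J j).1 : ℕ) * b ^ ((J j).2 : ℕ)) ^ (i.2 : ℕ)).det ≠ 0 := by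
  refine exists_det_submatrix_ne_zero (Matrix.of fun (i : Fin K × Fin 3) (n : Fin R × Fin S) =>
      (3 * ((n.1 : ℕ) : ℝ) + p * ((n.2 : ℕ) : ℝ) - x₀) ^ (i.1 : ℕ) / ((i.1 : ℕ)! : ℝ) *
        (a ^ (n.1 : ℕ) * b ^ (n.2 : ℕ)) ^ (i.2 : ℕ)) ?_
  rw [Fintype.linearIndependent_iff]
  intro c hc
  set q : Fin 3 → ℝ[X] := fun l => ∑ k : Fin K, C (c (k, l) / ((k : ℕ)! : ℝ)) * X ^ (k : ℕ) with hq
  have hq0 := eq_zero_of_grid_relation hR hcard hK ha ha1 hb x₀ q (fun l => ?_) (fun r s => ?_)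
  · rintro ⟨k, l⟩
    have := congrArg (fun f => coeff f (k : ℕ)) (hq0 l)
    simp only [hq, finsetSum_coeff, coeff_C_mul, coeff_X_pow, coeff_zero, Fin.val_inj] at this
    simp [Nat.factorial_ne_zero] at this
    exact this
  · refine lt_of_le_of_lt (b := K - 1) (natDegree_sum_le_of_forall_le _ _ fun k _ => ?_) (by omega)
    refine (natDegree_C_mul_X_pow_le _ _).trans ?_
    have := k.2
    omega
  · have := congrFun hc (r, s)
    rw [Pi.zero_apply, Finset.sum_apply, Fintype.sum_prod_type_right] at this
    refine Eq.trans (Finset.sum_congr rfl fun l _ => ?_) this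
    simp only [hq, eval_finsetSum, Finset.sum_mul]
    refine Finset.sum_congr rfl fun k _ => ?_
    simp [Matrix.row]
    ring

open Polynomial in
open scoped Nat in
/-- The change of basis from shifted monomials to binomial coefficients is unitriangular. -/
theorem exists_choose_eq_sum_shift (K : ℕ) (x₀ : ℝ) : ∃ T : Matrix (Fin K) (Fin K) ℝ, T.det = 1 ∧
    ∀ (k : Fin K) (x : ℕ),
      ∑ i, T k i * (((x : ℝ) - x₀) ^ (i : ℕ) / ((i : ℕ)! : ℝ)) = (x.choose k : ℝ) := by
  set q : ℕ → ℝ[X] := fun k => (descPochhammer ℝ k).comp (X + C x₀) with hq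
  have hdeg : ∀ k, (q k).natDegree = k := fun k => by
    rw [hq, (natDegree_comp_X_add_C_and_coeff _ _).1, descPochhammer_natDegree]
  have hcoeff : ∀ k, (q k).coeff k = 1 := fun k => by
    have := (natDegree_comp_X_add_C_and_coeff (descPochhammer ℝ k) x₀).2
    rwa [descPochhammer_natDegree, (monic_descPochhammer ℝ k).leadingCoeff] at this
  refine ⟨Matrix.of fun k i => (q k).coeff i * ((i : ℕ)! : ℝ) / ((k : ℕ)! : ℝ), ?_, fun k x => ?_⟩
  · rw [Matrix.det_of_isLowerTriangular]
    · refine Finset.prod_eq_one fun k _ => ?_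
      rw [Matrix.of_apply, hcoeff, one_mul, div_self (Nat.cast_ne_zero.2 (Nat.factorial_ne_zero _))]
    · intro k i hki
      have : (k : ℕ) < i := hki
      rw [Matrix.of_apply, coeff_eq_zero_of_natDegree_lt (by rwa [hdeg])]
      simp
  · have h1 : (q k).eval ((x : ℝ) - x₀) = (k : ℕ)! * (x.choose k : ℝ) := by
      rw [hq, eval_comp, eval_add, eval_X, eval_C, sub_add_cancel,
        descPochhammer_eval_eq_descFactorial, Nat.descFactorial_eq_factorial_mul_choose]
      push_cast
      rfl
    have h2 : (q k).eval ((x : ℝ) - x₀) =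
        ∑ i : Fin K, (q k).coeff i * ((x : ℝ) - x₀) ^ (i : ℕ) := by
      rw [eval_eq_sum_range' (n := K) (by rw [hdeg]; exact k.2),
        Fin.sum_univ_eq_sum_range (fun i => (q k).coeff i * ((x : ℝ) - x₀) ^ i)]
    have hk : ((k : ℕ)! : ℝ) ≠ 0 := Nat.cast_ne_zero.2 (Nat.factorial_ne_zero _)
    have h3 : (x.choose k : ℝ) = (q k).eval ((x : ℝ) - x₀) / ((k : ℕ)! : ℝ) := by
      rw [h1]; field_simp
    rw [h3, h2, Finset.sum_div]
    refine Finset.sum_congr rfl fun i _ => ?_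
    have hi : ((i : ℕ)! : ℝ) ≠ 0 := Nat.cast_ne_zero.2 (Nat.factorial_ne_zero _)
    rw [Matrix.of_apply]
    field_simp

open scoped Nat Kronecker in
/-- Liouville-type lower bound for an interpolation determinant. -/
theorem one_le_pow_mul_abs_interpolation_det {K : ℕ} (x : Fin K × Fin 3 → ℕ) (x₀ : ℝ)
    (E : Fin 3 → Fin K × Fin 3 → ℝ) (D : Fin 3 → ℕ) (hD : ∀ l j, ∃ n : ℤ, (D l : ℝ) * E l j = n)
    (hD0 : ∀ l, D l ≠ 0)
    (hdet : (Matrix.of fun i j : Fin K × Fin 3 =>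
      ((x j : ℝ) - x₀) ^ (i.1 : ℕ) / ((i.1 : ℕ)! : ℝ) * E i.2 j).det ≠ 0) :
    1 ≤ ((∏ l, D l : ℕ) : ℝ) ^ K * |(Matrix.of fun i j : Fin K × Fin 3 =>
      ((x j : ℝ) - x₀) ^ (i.1 : ℕ) / ((i.1 : ℕ)! : ℝ) * E i.2 j).det| := by
  obtain ⟨T, hT, hTx⟩ := exists_choose_eq_sum_shift K x₀
  choose n hn using hD
  set A : Matrix (Fin K × Fin 3) (Fin K × Fin 3) ℝ := Matrix.of fun i j : Fin K × Fin 3 =>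
      ((x j : ℝ) - x₀) ^ (i.1 : ℕ) / ((i.1 : ℕ)! : ℝ) * E i.2 j with hA
  have hB : (T ⊗ₖ (1 : Matrix (Fin 3) (Fin 3) ℝ)) * A = Matrix.of fun i j : Fin K × Fin 3 =>
      ((x j).choose i.1 : ℝ) * E i.2 j := by
    ext i j
    rw [Matrix.mul_apply, Fintype.sum_prod_type, Matrix.of_apply, ← hTx, Finset.sum_mul]
    refine Finset.sum_congr rfl fun k _ => ?_
    simp [hA, Matrix.kroneckerMap_apply, Matrix.one_apply]
    ring
  have hdetB := congrArg Matrix.det hB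
  rw [Matrix.det_mul, Matrix.det_kronecker, hT, Matrix.det_one, one_pow, one_pow, one_mul,
    one_mul] at hdetB
  have h_int : (Matrix.of fun i j : Fin K × Fin 3 => (D i.2 : ℝ) * (((x j).choose i.1 : ℝ) * E i.2 j))
      = (Matrix.of fun i j : Fin K × Fin 3 => ((x j).choose i.1 : ℤ) * n i.2 j).map
        (Int.castRingHom ℝ) := by
    ext i j
    simp only [Matrix.of_apply, Matrix.map_apply]
    rw [mul_left_comm, hn]
    simp
  have hscale : (Matrix.of fun i j : Fin K × Fin 3 =>
      (D i.2 : ℝ) * (((x j).choose i.1 : ℝ) * E i.2 j)).det =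
      ((∏ l, D l : ℕ) : ℝ) ^ K * A.det := by
    rw [hdetB]
    refine (Matrix.det_mul_column (fun i : Fin K × Fin 3 => (D i.2 : ℝ)) _).trans ?_
    congr 1
    rw [Fintype.prod_prod_type]
    simp
  rw [h_int, ← RingHom.mapMatrix_apply, ← RingHom.map_det] at hscale
  have hpos : ((∏ l, D l : ℕ) : ℝ) ^ K ≠ 0 :=
    pow_ne_zero _ (Nat.cast_ne_zero.2 (Finset.prod_ne_zero_iff.2 fun l _ => hD0 l))
  have hne := mul_ne_zero hpos hdet
  have habs : ((∏ l, D l : ℕ) : ℝ) ^ K * |A.det| = |((∏ l, D l : ℕ) : ℝ) ^ K * A.det| := by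
    rw [abs_mul, abs_pow, Nat.abs_cast]
  rw [habs]
  rw [← hscale] at hne ⊢
  rw [eq_intCast] at hne ⊢
  rw [← Int.cast_abs]
  exact_mod_cast Int.one_le_abs (by exact_mod_cast hne)
/-- Naturals that are pairwise distinct below their number sum to at least a triangular number. -/
theorem card_mul_card_sub_one_le_two_mul_sum {ι : Type*} [Fintype ι] [DecidableEq ι] (d : ι → ℕ)
    (hd : ∀ i j, i ≠ j → d i = d j → Fintype.card ι ≤ d i) :
    Fintype.card ι * (Fintype.card ι - 1) ≤ 2 * ∑ i, d i := by
  set M := Fintype.card ι with hM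
  set s := Finset.univ.filter fun i => d i < M with hs
  have hinj : Set.InjOn d s := by
    intro i hi j _ hij
    by_contra hne
    have := hd i j hne hij
    simp [hs] at hi
    omega
  have hsub : s.image d ⊆ Finset.range M := by
    intro v hv
    simp [hs] at hv ⊢
    obtain ⟨i, hi, rfl⟩ := hv
    exact hi
  have h1 : ∑ v ∈ Finset.range M \ s.image d, v ≤ (Finset.range M \ s.image d).card * M := by
    refine Finset.sum_le_card_nsmul _ _ _ fun v hv => ?_
    simp at hv
    exact hv.1.le
  have hcard : (Finset.range M \ s.image d).card = sᶜ.card := by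
    rw [Finset.card_sdiff_of_subset hsub, Finset.card_compl, Finset.card_image_of_injOn hinj,
      Finset.card_range]
  have h2 : sᶜ.card * M ≤ ∑ i ∈ sᶜ, d i := by
    refine Finset.card_nsmul_le_sum _ _ _ fun i hi => ?_
    simpa [hs] using hi
  have h3 : ∑ v ∈ s.image d, v = ∑ i ∈ s, d i := Finset.sum_image hinj
  have h4 := Finset.sum_sdiff hsub (f := fun v => v)
  have h5 := Finset.sum_add_sum_compl s d
  have h6 := Finset.sum_range_id_mul_two M
  rw [hcard] at h1
  omega

open scoped Nat in
theorem abs_det_le_factorial_mul_prod {ι : Type*} [Fintype ι] [DecidableEq ι] (A : Matrix ι ι ℝ)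
    (m : ι → ℝ) (hA : ∀ i j, |A i j| ≤ m i) :
    |A.det| ≤ (Fintype.card ι)! * ∏ i, m i := by
  rw [Matrix.det_apply]
  refine (Finset.abs_sum_le_sum_abs _ _).trans ?_
  refine (Finset.sum_le_card_nsmul _ _ (∏ i, m i) fun σ _ => ?_).trans ?_
  · rw [Units.smul_def, zsmul_eq_mul, abs_mul, Finset.abs_prod]
    have : |((Equiv.Perm.sign σ : ℤ) : ℝ)| = 1 := by
      rcases Int.units_eq_one_or (Equiv.Perm.sign σ) with h | h <;> simp [h]
    rw [this, one_mul, ← Equiv.prod_comp σ m]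
    exact Finset.prod_le_prod (fun _ _ => abs_nonneg _) fun i _ => hA _ _
  · simp [Fintype.card_perm]

open scoped Nat in
/-- A determinant whose rows are polynomials in `x j` plus small errors is small. -/
theorem pow_mul_abs_det_sum_le {ι : Type*} [Fintype ι] [DecidableEq ι] (k : ι → ℕ) (x : ι → ℝ)
    (V : ι → ℕ → ι → ℝ) (m : ι → ℝ) (β : ℕ → ℝ) (t G : ℝ) (N : ℕ) (ht : 1 ≤ t)
    (hm : ∀ i, 0 ≤ m i) (hβ : ∀ n, 0 ≤ β n) (hV : ∀ i n j, |V i n j| ≤ m i * β n)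
    (hpow : ∀ i n, n < Fintype.card ι → ∃ c, ∀ j, V i n j = c * x j ^ (k i + n))
    (hN : 2 * (∑ i, k i + N) ≤ Fintype.card ι * (Fintype.card ι - 1))
    (hG : ∑ n ∈ Finset.range (Fintype.card ι + 1), t ^ n * β n ≤ G) :
    t ^ N * |(Matrix.of fun i j =>
      ∑ n ∈ Finset.range (Fintype.card ι + 1), V i n j).det| ≤
      (Fintype.card ι)! * (∏ i, m i) * G ^ Fintype.card ι := by
  set M := Fintype.card ι with hM
  have hexp : (Matrix.of fun i j => ∑ n ∈ Finset.range (M + 1), V i n j).det =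
      ∑ f ∈ Fintype.piFinset fun _ : ι => Finset.range (M + 1),
        (Matrix.of fun i j => V i (f i) j).det := by
    have := (Matrix.detRowAlternating (n := ι) (R := ℝ)).toMultilinearMap.map_sum_finset
      (fun i n => V i n) (fun _ => Finset.range (M + 1))
    refine Eq.trans ?_ this
    change Matrix.det _ = Matrix.det _
    congr 1
    ext i j
    simp
  have hterm : ∀ f : ι → ℕ, t ^ N * |(Matrix.of fun i j => V i (f i) j).det| ≤
      M ! * (∏ i, m i) * ∏ i, t ^ f i * β (f i) := by
    intro f
    have hnn : 0 ≤ (M ! : ℝ) * (∏ i, m i) * ∏ i, t ^ f i * β (f i) := by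
      have h1 := Finset.prod_nonneg fun i (_ : i ∈ Finset.univ) => hm i
      have h2 := Finset.prod_nonneg fun i (_ : i ∈ Finset.univ) =>
        mul_nonneg (pow_nonneg (zero_le_one.trans ht) (f i)) (hβ (f i))
      positivity
    by_cases hd : ∀ i j, i ≠ j → k i + f i = k j + f j → M ≤ k i + f i
    · have h1 := card_mul_card_sub_one_le_two_mul_sum (fun i => k i + f i) hd
      rw [Finset.sum_add_distrib, ← hM] at h1
      have h2 : N ≤ ∑ i, f i := by omega
      have h3 := abs_det_le_factorial_mul_prod (Matrix.of fun i j => V i (f i) j)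
        (fun i => m i * β (f i)) (fun i j => hV i (f i) j)
      rw [Finset.prod_mul_distrib, Finset.prod_pow_eq_pow_sum]
      calc t ^ N * |(Matrix.of fun i j => V i (f i) j).det|
          ≤ t ^ (∑ i, f i) * (M ! * ∏ i, m i * β (f i)) := by
            gcongr
        _ = _ := by rw [Finset.prod_mul_distrib]; ring
    · push Not at hd
      obtain ⟨i, j, hij, heq, hlt⟩ := hd
      obtain ⟨c, hc⟩ := hpow i (f i) (by omega)
      obtain ⟨c', hc'⟩ := hpow j (f j) (by omega)
      rw [show (Matrix.of fun i j => V i (f i) j).det = 0 from ?_]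
      · simpa using hnn
      · by_cases h0 : c' = 0
        · refine Matrix.det_eq_zero_of_row_eq_zero j fun l => ?_
          simp [hc', h0]
        · by_contra hdet
          have hli := Matrix.linearIndependent_rows_of_det_ne_zero hdet
          rw [linearIndependent_iff'] at hli
          have := hli {i, j} (fun l => if l = i then c' else -c) ?_ i (by simp)
          · simp at this
            exact h0 this
          · rw [Finset.sum_pair hij]
            ext l
            simp [hij.symm, hc, hc', heq]
            ring
  rw [hexp]
  calc t ^ N * |∑ f ∈ Fintype.piFinset fun _ : ι => Finset.range (M + 1),
        (Matrix.of fun i j => V i (f i) j).det|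
      ≤ ∑ f ∈ Fintype.piFinset fun _ : ι => Finset.range (M + 1),
        t ^ N * |(Matrix.of fun i j => V i (f i) j).det| := by
        rw [← Finset.mul_sum]
        gcongr
        exact Finset.abs_sum_le_sum_abs _ _
    _ ≤ ∑ f ∈ Fintype.piFinset fun _ : ι => Finset.range (M + 1),
        M ! * (∏ i, m i) * ∏ i, t ^ f i * β (f i) := Finset.sum_le_sum fun f _ => hterm f
    _ = M ! * (∏ i, m i) * (∑ n ∈ Finset.range (M + 1), t ^ n * β n) ^ M := by
        rw [← Finset.mul_sum, ← Finset.prod_univ_sum (fun _ : ι => Finset.range (M + 1))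
          (fun _ n => t ^ n * β n), Finset.prod_const, Finset.card_univ]
    _ ≤ _ := by
        have h1 := Finset.prod_nonneg fun i (_ : i ∈ Finset.univ) => hm i
        have h2 : 0 ≤ ∑ n ∈ Finset.range (M + 1), t ^ n * β n :=
          Finset.sum_nonneg fun n _ => mul_nonneg (pow_nonneg (zero_le_one.trans ht) n) (hβ n)
        gcongr

open scoped Nat in
theorem pow_mul_exp_sub_sum_le (t W : ℝ) (ht : 1 ≤ t) (hW : 0 ≤ W) (M : ℕ) :
    t ^ M * (Real.exp W - ∑ n ∈ Finset.range M, W ^ n / n !) ≤ Real.exp (t * W) := by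
  have hs := Real.summable_pow_div_factorial W
  have hs' := Real.summable_pow_div_factorial (t * W)
  have h1 : Real.exp W - ∑ n ∈ Finset.range M, W ^ n / (n ! : ℝ) =
      ∑' n, W ^ (n + M) / ((n + M)! : ℝ) := by
    rw [Real.exp_eq_exp_ℝ, NormedSpace.exp_eq_tsum_div]
    beta_reduce
    rw [← hs.sum_add_tsum_nat_add M]
    ring
  have h2 : Real.exp (t * W) = ∑ n ∈ Finset.range M, (t * W) ^ n / (n ! : ℝ) +
      ∑' n, (t * W) ^ (n + M) / ((n + M)! : ℝ) := by
    rw [Real.exp_eq_exp_ℝ, NormedSpace.exp_eq_tsum_div]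
    beta_reduce
    rw [← hs'.sum_add_tsum_nat_add M]
  have h3 : 0 ≤ ∑ n ∈ Finset.range M, (t * W) ^ n / (n ! : ℝ) :=
    Finset.sum_nonneg fun n _ => by positivity
  rw [h1, h2, ← tsum_mul_left]
  refine le_trans ?_ (le_add_of_nonneg_left h3)
  refine Summable.tsum_le_tsum (fun n => ?_) (((summable_nat_add_iff M).2 hs).mul_left _)
    ((summable_nat_add_iff M).2 hs')
  rw [mul_pow, mul_div_assoc]
  gcongr
  omega

open scoped Nat in
theorem abs_exp_sub_sum_le (W z : ℝ) (hz : |z| ≤ W) (M : ℕ) :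
    |Real.exp z - ∑ n ∈ Finset.range M, z ^ n / n !| ≤
      Real.exp W - ∑ n ∈ Finset.range M, W ^ n / n ! := by
  have hs' := Real.summable_pow_div_factorial W
  have h1 : ∀ y : ℝ, Real.exp y - ∑ n ∈ Finset.range M, y ^ n / (n ! : ℝ) =
      ∑' n, y ^ (n + M) / ((n + M)! : ℝ) := by
    intro y
    rw [Real.exp_eq_exp_ℝ, NormedSpace.exp_eq_tsum_div]
    beta_reduce
    rw [← (Real.summable_pow_div_factorial y).sum_add_tsum_nat_add M]
    ring
  rw [h1, h1, ← Real.norm_eq_abs]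
  refine tsum_of_norm_bounded ((summable_nat_add_iff M).2 hs').hasSum fun n => ?_
  rw [norm_div, norm_pow, Real.norm_eq_abs, Real.norm_natCast]
  gcongr

theorem abs_exp_mul_add_sub_exp_le {W ε z η c : ℝ} (hc : |c| ≤ 1) (hz : |z| ≤ W) (hη : 0 ≤ η)
    (hηε : η ≤ ε) (hε : ε ≤ 1) :
    |Real.exp (c * (z + η)) - Real.exp (c * z)| ≤ 2 * ε * Real.exp W := by
  have h1 : |c * η| ≤ ε := by
    rw [abs_mul, abs_of_nonneg hη]
    nlinarith [abs_nonneg c]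
  have h2 := Real.abs_exp_sub_one_le (h1.trans hε)
  have h3 : Real.exp (c * z) ≤ Real.exp W := by
    rw [Real.exp_le_exp]
    refine (le_abs_self _).trans ?_
    rw [abs_mul]
    nlinarith [abs_nonneg c, abs_nonneg z]
  calc |Real.exp (c * (z + η)) - Real.exp (c * z)|
      = |Real.exp (c * η) - 1| * Real.exp (c * z) := by
        rw [mul_add, Real.exp_add, ← abs_of_pos (Real.exp_pos (c * z)), ← abs_mul,
          abs_of_pos (Real.exp_pos (c * z))]
        ring_nf
    _ ≤ (2 * ε) * Real.exp W := by
        have h4 : |Real.exp (c * η) - 1| ≤ 2 * ε := by linarith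
        have h5 : 0 ≤ 2 * ε := by linarith
        gcongr

open scoped Nat in
/-- Upper bound for a Laurent interpolation determinant in `x` and `exp (w * x)`. -/
theorem pow_mul_abs_interpolation_det_le {K : ℕ} (x η : Fin K × Fin 3 → ℝ)
    {w X W t ε : ℝ} (ht : 1 ≤ t) (hx : ∀ j, |x j| ≤ X) (hX : 0 ≤ X) (hW : |w| * X ≤ W)
    (hη : ∀ j, 0 ≤ η j) (hηε : ∀ j, η j ≤ ε) (hε : 0 ≤ ε) (hε1 : t ^ (3 * K) * ε ≤ 1) :
    t ^ (3 * K ^ 2) * |(Matrix.of fun i j : Fin K × Fin 3 => x j ^ (i.1 : ℕ) / ((i.1 : ℕ)! : ℝ) *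
      Real.exp ((((i.2 : ℕ) : ℝ) - 1) * (w * x j + η j))).det| ≤
      (3 * K)! * (∏ i : Fin K × Fin 3, X ^ (i.1 : ℕ) / ((i.1 : ℕ)! : ℝ)) *
        (4 * Real.exp (t * W)) ^ (3 * K) := by
  have hcard : Fintype.card (Fin K × Fin 3) = 3 * K := by simp [mul_comm]
  have hε' : ε ≤ 1 := by
    have := one_le_pow₀ ht (n := 3 * K)
    nlinarith
  have hW0 : 0 ≤ W := le_trans (by positivity) hW
  have hl : ∀ l : Fin 3, |((l : ℕ) : ℝ) - 1| ≤ 1 := by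
    intro l; fin_cases l <;> norm_num
  have hwx : ∀ j, |w * x j| ≤ W := fun j => by
    rw [abs_mul]
    exact (mul_le_mul_of_nonneg_left (hx j) (abs_nonneg _)).trans hW
  have hlwx : ∀ (l : Fin 3) j, |(((l : ℕ) : ℝ) - 1) * (w * x j)| ≤ W := fun l j => by
    rw [abs_mul]
    have := hl l
    have := hwx j
    have := abs_nonneg (((l : ℕ) : ℝ) - 1)
    nlinarith [abs_nonneg (w * x j)]
  set D : ℝ := (Real.exp W - ∑ n ∈ Finset.range (3 * K), W ^ n / (n ! : ℝ)) +
    2 * ε * Real.exp W with hD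
  set S : Fin 3 → Fin K × Fin 3 → ℝ := fun l j =>
    ∑ n ∈ Finset.range (3 * K), ((((l : ℕ) : ℝ) - 1) * (w * x j)) ^ n / (n ! : ℝ) with hS
  have htail := pow_mul_exp_sub_sum_le t W ht hW0 (3 * K)
  have hδ : ∀ (l : Fin 3) j, |Real.exp ((((l : ℕ) : ℝ) - 1) * (w * x j + η j)) - S l j| ≤ D := by
    intro l j
    have h1 := abs_exp_sub_sum_le W _ (hlwx l j) (3 * K)
    have h2 := abs_exp_mul_add_sub_exp_le (hl l) (hwx j) (hη j) (hηε j) hε'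
    refine (abs_sub_le _ (Real.exp ((((l : ℕ) : ℝ) - 1) * (w * x j))) _).trans ?_
    rw [hD]
    linarith
  have hD0 : 0 ≤ D := by
    have := abs_exp_sub_sum_le W W (abs_of_nonneg hW0).le (3 * K)
    have h2 := (abs_nonneg _).trans this
    positivity
  have key := pow_mul_abs_det_sum_le (ι := Fin K × Fin 3) (fun i => i.1) x
    (fun i n j => x j ^ (i.1 : ℕ) / ((i.1 : ℕ)! : ℝ) * if n < 3 * K then
        ((((i.2 : ℕ) : ℝ) - 1) * (w * x j)) ^ n / (n ! : ℝ)
      else if n = 3 * K then Real.exp ((((i.2 : ℕ) : ℝ) - 1) * (w * x j + η j)) - S i.2 j else 0)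
    (fun i => X ^ (i.1 : ℕ) / ((i.1 : ℕ)! : ℝ))
    (fun n => if n < 3 * K then W ^ n / (n ! : ℝ) else if n = 3 * K then D else 0)
    t (4 * Real.exp (t * W)) (3 * K ^ 2) ht (fun i => by positivity) ?_ ?_ ?_ ?_ ?_
  · rw [hcard] at key
    convert key using 6 with i
    funext j
    rw [← Finset.mul_sum, Finset.sum_range_succ, if_neg (lt_irrefl _), if_pos rfl,
      Finset.sum_congr rfl fun n hn => if_pos (Finset.mem_range.1 hn)]
    simp [hS]
  · intro n
    split_ifs
    · positivity
    · exact hD0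
    · exact le_rfl
  · intro i n j
    rw [abs_mul, abs_div, abs_pow, Nat.abs_cast]
    have := hx j
    gcongr
    split_ifs
    · rw [abs_div, abs_pow, Nat.abs_cast]
      have := hlwx i.2 j
      gcongr
    · exact hδ _ _
    · simp
  · intro i n hn
    rw [hcard] at hn
    refine ⟨1 / ((i.1 : ℕ)! : ℝ) * ((((i.2 : ℕ) : ℝ) - 1) * w) ^ n / (n ! : ℝ), fun j => ?_⟩
    rw [if_pos hn, pow_add, ← mul_assoc, mul_pow _ (x j)]
    ring
  · rw [hcard, Fintype.sum_prod_type]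
    simp only [Finset.sum_const, Finset.card_univ, Fintype.card_fin, smul_eq_mul]
    rw [← Finset.mul_sum, Fin.sum_univ_eq_sum_range (fun k => k)]
    have := Finset.sum_range_id_mul_two K
    rcases K with _ | K
    · simp
    · rw [Nat.add_sub_cancel] at this
      rw [show 3 * (K + 1) - 1 = 3 * K + 2 by omega]
      nlinarith
  · rw [hcard, Finset.sum_range_succ, if_neg (lt_irrefl _), if_pos rfl,
      Finset.sum_congr rfl fun n hn => by rw [if_pos (Finset.mem_range.1 hn)]]
    have h1 : ∑ n ∈ Finset.range (3 * K), t ^ n * (W ^ n / (n ! : ℝ)) ≤ Real.exp (t * W) := by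
      refine le_trans (Finset.sum_le_sum fun n _ => le_of_eq ?_)
        (Real.sum_le_exp_of_nonneg (mul_nonneg (zero_le_one.trans ht) hW0) (3 * K))
      rw [mul_pow, mul_div_assoc]
    have h2 : Real.exp W ≤ Real.exp (t * W) := by
      rw [Real.exp_le_exp]
      nlinarith
    have h3 : t ^ (3 * K) * (2 * ε * Real.exp W) ≤ 2 * Real.exp (t * W) := by
      have : t ^ (3 * K) * (2 * ε * Real.exp W) = 2 * (t ^ (3 * K) * ε) * Real.exp W := by ring
      rw [this]
      nlinarith [Real.exp_pos W]
    rw [hD, mul_add]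
    linarith

theorem exists_int_pow_mul_eq {u v g₁ g₂ R S r s : ℕ} (hv : 0 < v) (hg₂ : 0 < g₂) (hr : r < R)
    (hs : s < S) : ∃ n : ℤ, ((v ^ (R - 1) * g₂ ^ (S - 1) : ℕ) : ℝ) *
      (((u : ℝ) / v) ^ r * ((g₁ : ℝ) / g₂) ^ s) = n := by
  refine ⟨((v ^ (R - 1 - r) * g₂ ^ (S - 1 - s) * (u ^ r * g₁ ^ s) : ℕ) : ℤ), ?_⟩
  have h1 : (v : ℝ) ^ (R - 1) = v ^ (R - 1 - r) * v ^ r := by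
    rw [← pow_add]; congr 1; omega
  have h2 : (g₂ : ℝ) ^ (S - 1) = g₂ ^ (S - 1 - s) * g₂ ^ s := by
    rw [← pow_add]; congr 1; omega
  push_cast
  rw [h1, h2, div_pow, div_pow]
  field_simp

open scoped Nat in
/-- The basic inequality obtained from an interpolation determinant for a rational `u / v` whose
`p`-th power is very close to the cube of `g₁ / g₂`. -/
theorem pow_le_of_pow_eq_cube_mul {u v g₁ g₂ p R S K : ℕ} (hu : 0 < u) (hv : 0 < v)
    (hg₁ : 0 < g₁) (hg₂ : 0 < g₂) (huv : u ≠ v) (hp : 0 < p) (hR : 3 * R ≤ p)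
    (hcard : 3 * K ≤ (R - 2) * S) (hK : 0 < K) {ε t W X : ℝ} (hε : 0 ≤ ε) (ht : 1 ≤ t)
    (htε : t ^ (3 * K) * ε ≤ 1)
    (heq : ((u : ℝ) / v) ^ p = ((g₁ : ℝ) / g₂) ^ 3 * (1 + ε))
    (hX : X = (3 * ((R : ℝ) - 1) + p * ((S : ℝ) - 1)) / 2)
    (hW : |Real.log ((g₁ : ℝ) / g₂) / p| * X ≤ W) :
    t ^ (3 * K ^ 2) ≤ ((u ^ (R - 1) * g₁ ^ (S - 1) * (v ^ (R - 1) * g₂ ^ (S - 1)) : ℕ) : ℝ) ^ K *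
      ((3 * K)! * (∏ i : Fin K × Fin 3, X ^ (i.1 : ℕ) / ((i.1 : ℕ)! : ℝ)) *
        (4 * Real.exp (t * W)) ^ (3 * K)) := by
  set a : ℝ := (u : ℝ) / v with ha
  set b : ℝ := (g₁ : ℝ) / g₂ with hb
  have ha0 : 0 < a := by positivity
  have hb0 : 0 < b := by positivity
  have ha1 : a ≠ 1 := by
    rw [ha, Ne, div_eq_one_iff_eq (by positivity)]
    exact_mod_cast huv
  obtain ⟨J, hJ⟩ := exists_grid_det_ne_zero hR hcard hK ha0 ha1 hb0 X
  set r : Fin K × Fin 3 → ℕ := fun j => (J j).1 with hr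
  set s : Fin K × Fin 3 → ℕ := fun j => (J j).2 with hs
  have hrR : ∀ j, r j < R := fun j => (J j).1.2
  have hsS : ∀ j, s j < S := fun j => (J j).2.2
  set y : Fin K × Fin 3 → ℝ := fun j => a ^ r j * b ^ s j with hy
  have hy0 : ∀ j, 0 < y j := fun j => by positivity
  set x : Fin K × Fin 3 → ℕ := fun j => 3 * r j + p * s j with hx
  set w : ℝ := Real.log b / p with hw
  set η : Fin K × Fin 3 → ℝ := fun j => r j / p * Real.log (1 + ε) with hη
  have hp0 : (0 : ℝ) < p := by exact_mod_cast hp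
  have hlog0 : 0 ≤ Real.log (1 + ε) := Real.log_nonneg (by linarith)
  have hlogε : Real.log (1 + ε) ≤ ε := by
    have := Real.log_le_sub_one_of_pos (show 0 < 1 + ε by linarith)
    linarith
  have hloga : p * Real.log a = 3 * Real.log b + Real.log (1 + ε) := by
    have := congrArg Real.log heq
    rw [Real.log_pow, Real.log_mul (by positivity) (by positivity), Real.log_pow] at this
    exact_mod_cast this
  have hlogy : ∀ j, Real.log (y j) = w * ((x j : ℝ) - X) + η j + w * X := fun j => by
    rw [hy, Real.log_mul (by positivity) (by positivity), Real.log_pow, Real.log_pow,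
      show Real.log a = (3 * Real.log b + Real.log (1 + ε)) / p by
        rw [← hloga]; field_simp, hw, hη, hx]
    push_cast
    field_simp
    ring
  set E : Fin 3 → Fin K × Fin 3 → ℝ := fun l j => y j ^ (l : ℕ) * (y j)⁻¹ with hE
  have hEexp : ∀ l j, E l j = Real.exp ((((l : ℕ) : ℝ) - 1) * (w * X)) *
      Real.exp ((((l : ℕ) : ℝ) - 1) * (w * ((x j : ℝ) - X) + η j)) := fun l j => by
    have h1 : y j = Real.exp (Real.log (y j)) := (Real.exp_log (hy0 j)).symm
    rw [hE]
    beta_reduce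
    rw [h1, ← Real.exp_nat_mul, ← Real.exp_neg, ← Real.exp_add, ← Real.exp_add, hlogy]
    congr 1
    ring
  have hdetE : (Matrix.of fun i j : Fin K × Fin 3 =>
      ((x j : ℝ) - X) ^ (i.1 : ℕ) / ((i.1 : ℕ)! : ℝ) * E i.2 j).det ≠ 0 := by
    have : (Matrix.of fun i j : Fin K × Fin 3 =>
        ((x j : ℝ) - X) ^ (i.1 : ℕ) / ((i.1 : ℕ)! : ℝ) * E i.2 j) =
        Matrix.of fun i j : Fin K × Fin 3 => (y j)⁻¹ * (Matrix.of fun i j : Fin K × Fin 3 =>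
      (3 * (((J j).1 : ℕ) : ℝ) + p * (((J j).2 : ℕ) : ℝ) - X) ^ (i.1 : ℕ) / ((i.1 : ℕ)! : ℝ) *
        (a ^ ((J j).1 : ℕ) * b ^ ((J j).2 : ℕ)) ^ (i.2 : ℕ)) i j := by
      ext i j
      simp only [Matrix.of_apply, hE, hy, hx, hr, hs]
      push_cast
      ring
    rw [this, Matrix.det_mul_row]
    exact mul_ne_zero (Finset.prod_ne_zero_iff.2 fun j _ => (inv_pos.2 (hy0 j)).ne') hJ
  have hdetexp : (Matrix.of fun i j : Fin K × Fin 3 =>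
      ((x j : ℝ) - X) ^ (i.1 : ℕ) / ((i.1 : ℕ)! : ℝ) * E i.2 j).det =
      (Matrix.of fun i j : Fin K × Fin 3 => ((x j : ℝ) - X) ^ (i.1 : ℕ) / ((i.1 : ℕ)! : ℝ) *
      Real.exp ((((i.2 : ℕ) : ℝ) - 1) * (w * ((x j : ℝ) - X) + η j))).det := by
    have : (Matrix.of fun i j : Fin K × Fin 3 =>
        ((x j : ℝ) - X) ^ (i.1 : ℕ) / ((i.1 : ℕ)! : ℝ) * E i.2 j) =
        Matrix.of fun i j : Fin K × Fin 3 => Real.exp ((((i.2 : ℕ) : ℝ) - 1) * (w * X)) *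
        (Matrix.of fun i j : Fin K × Fin 3 => ((x j : ℝ) - X) ^ (i.1 : ℕ) / ((i.1 : ℕ)! : ℝ) *
      Real.exp ((((i.2 : ℕ) : ℝ) - 1) * (w * ((x j : ℝ) - X) + η j))) i j := by
      ext i j
      simp only [Matrix.of_apply, hEexp]
      ring
    rw [this]
    refine (Matrix.det_mul_column
      (fun i : Fin K × Fin 3 => Real.exp ((((i.2 : ℕ) : ℝ) - 1) * (w * X))) _).trans ?_
    rw [← Real.exp_sum, Fintype.sum_prod_type]
    simp only [Fin.sum_univ_three]
    norm_num
  have hR1 : (1 : ℝ) ≤ R := by exact_mod_cast (hrR (⟨0, hK⟩, 0)).pos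
  have hS1 : (1 : ℝ) ≤ S := by exact_mod_cast (hsS (⟨0, hK⟩, 0)).pos
  have hX0 : 0 ≤ X := by
    rw [hX]
    have := mul_nonneg hp0.le (sub_nonneg.2 hS1)
    linarith
  have hxX : ∀ j, |(x j : ℝ) - X| ≤ X := fun j => by
    have h1 : (r j : ℝ) + 1 ≤ R := by exact_mod_cast hrR j
    have h2 : (s j : ℝ) + 1 ≤ S := by exact_mod_cast hsS j
    have h3 : (p : ℝ) * s j ≤ p * ((S : ℝ) - 1) := by gcongr; linarith
    have h4 : (0 : ℝ) ≤ x j := Nat.cast_nonneg _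
    rw [abs_le]
    refine ⟨by linarith, ?_⟩
    have : (x j : ℝ) = 3 * r j + p * s j := by rw [hx]; push_cast; ring
    rw [this, hX]
    linarith
  have hη0 : ∀ j, 0 ≤ η j := fun j => by positivity
  have hηε : ∀ j, η j ≤ ε := fun j => by
    have h1 : (r j : ℝ) / p ≤ 1 := by
      rw [div_le_one hp0]
      have := hrR j
      exact_mod_cast (show r j ≤ p by omega)
    rw [hη]
    beta_reduce
    nlinarith
  have hup := pow_mul_abs_interpolation_det_le (fun j => (x j : ℝ) - X) η ht hxX hX0 hW hη0 hηε hε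
    htε
  rw [← hdetexp] at hup
  have hlow := one_le_pow_mul_abs_interpolation_det x X E
    ![u ^ (R - 1) * g₁ ^ (S - 1), 1, v ^ (R - 1) * g₂ ^ (S - 1)] ?_ ?_ hdetE
  · rw [Fin.prod_univ_three] at hlow
    simp only [Matrix.cons_val_zero, Matrix.cons_val_one, Matrix.cons_val_two,
      mul_one] at hlow
    calc t ^ (3 * K ^ 2) ≤ t ^ (3 * K ^ 2) *
          (((u ^ (R - 1) * g₁ ^ (S - 1) * (v ^ (R - 1) * g₂ ^ (S - 1)) : ℕ) : ℝ) ^ K *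
          |(Matrix.of fun i j : Fin K × Fin 3 =>
            ((x j : ℝ) - X) ^ (i.1 : ℕ) / ((i.1 : ℕ)! : ℝ) * E i.2 j).det|) :=
          le_mul_of_one_le_right (by positivity) hlow
      _ = ((u ^ (R - 1) * g₁ ^ (S - 1) * (v ^ (R - 1) * g₂ ^ (S - 1)) : ℕ) : ℝ) ^ K *
          (t ^ (3 * K ^ 2) * |(Matrix.of fun i j : Fin K × Fin 3 =>
            ((x j : ℝ) - X) ^ (i.1 : ℕ) / ((i.1 : ℕ)! : ℝ) * E i.2 j).det|) := by ring
      _ ≤ _ := by gcongr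
  · intro l j
    fin_cases l
    · obtain ⟨n, hn⟩ := exists_int_pow_mul_eq (u := v) (g₁ := g₂) hu hg₁ (hrR j) (hsS j)
      refine ⟨n, ?_⟩
      rw [← hn]
      simp [hE, hy, ha, hb, mul_comm, ← inv_pow]
    · refine ⟨1, ?_⟩
      simp [hE, mul_inv_cancel₀ (hy0 j).ne']
    · obtain ⟨n, hn⟩ := exists_int_pow_mul_eq (u := u) (g₁ := g₁) hv hg₂ (hrR j) (hsS j)
      refine ⟨n, ?_⟩
      rw [← hn]
      have : E 2 j = y j := by
        simp only [hE]
        rw [show ((2 : Fin 3) : ℕ) = 2 from rfl, pow_two, mul_assoc, mul_inv_cancel₀ (hy0 j).ne',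
          mul_one]
      simp [this, hy, ha, hb]
  · intro l
    fin_cases l
    · exact (by positivity : 0 < u ^ (R - 1) * g₁ ^ (S - 1)).ne'
    · exact one_ne_zero
    · exact (by positivity : 0 < v ^ (R - 1) * g₂ ^ (S - 1)).ne'

theorem inv_add_one_le_abs_log_sub {u v : ℕ} (hu : 0 < u) (hv : 0 < v) (huv : u ≠ v) :
    ((v : ℝ) + 1)⁻¹ ≤ |Real.log u - Real.log v| := by
  have hu0 : (0 : ℝ) < u := by exact_mod_cast hu
  have hv0 : (0 : ℝ) < v := by exact_mod_cast hv
  rcases lt_or_gt_of_ne huv with h | h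
  · have h1 : (u : ℝ) + 1 ≤ v := by exact_mod_cast h
    have h2 := Real.one_sub_inv_le_log_of_pos (div_pos hv0 hu0)
    rw [Real.log_div hv0.ne' hu0.ne', inv_div] at h2
    rw [abs_sub_comm]
    refine le_trans ?_ (h2.trans (le_abs_self _))
    rw [inv_eq_one_div, le_sub_iff_add_le, div_add_div _ _ (by positivity) hv0.ne',
      div_le_one (by positivity)]
    nlinarith
  · have h1 : (v : ℝ) + 1 ≤ u := by exact_mod_cast h
    have h2 := Real.one_sub_inv_le_log_of_pos (div_pos hu0 hv0)
    rw [Real.log_div hu0.ne' hv0.ne', inv_div] at h2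
    refine le_trans ?_ (h2.trans (le_abs_self _))
    rw [inv_eq_one_div, le_sub_iff_add_le, div_add_div _ _ (by positivity) hu0.ne',
      div_le_one (by positivity)]
    nlinarith

open scoped Nat in
theorem prod_pow_div_factorial_le {K : ℕ} {X c : ℝ} (hX : 0 ≤ X) (hc : 0 < c) :
    ∏ i : Fin K × Fin 3, X ^ (i.1 : ℕ) / ((i.1 : ℕ)! : ℝ) ≤
      (c ^ (∑ k ∈ Finset.range K, k) * Real.exp (X / c) ^ K) ^ 3 := by
  have h1 : ∀ k : ℕ, X ^ k / (k ! : ℝ) ≤ c ^ k * Real.exp (X / c) := fun k => by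
    have h2 := Real.pow_div_factorial_le_exp (X / c) (by positivity) k
    calc X ^ k / (k ! : ℝ) = c ^ k * ((X / c) ^ k / (k ! : ℝ)) := by
          rw [div_pow]; field_simp
      _ ≤ _ := by gcongr
  rw [Fintype.prod_prod_type]
  simp only [Finset.prod_const, Finset.card_univ, Fintype.card_fin]
  rw [Finset.prod_pow, Fin.prod_univ_eq_prod_range (fun k => X ^ k / (k ! : ℝ))]
  refine pow_le_pow_left₀ (Finset.prod_nonneg fun k _ => by positivity) ?_ 3
  refine (Finset.prod_le_prod (fun k _ => by positivity) fun k _ => h1 k).trans ?_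
  rw [Finset.prod_mul_distrib, Finset.prod_pow_eq_pow_sum, Finset.prod_const, Finset.card_range]

open scoped Nat in
/-- Logarithmic form of the basic inequality, normalised by the number of polynomial degrees. -/
theorem log_le_of_basic_inequality {D K : ℕ} {X t c W : ℝ} (hD : 0 < D) (hK : 0 < K) (hX : 0 ≤ X)
    (ht : 0 < t) (hc : 0 < c)
    (h : t ^ (3 * K ^ 2) ≤ (D : ℝ) ^ K *
      ((3 * K)! * (∏ i : Fin K × Fin 3, X ^ (i.1 : ℕ) / ((i.1 : ℕ)! : ℝ)) *
        (4 * Real.exp (t * W)) ^ (3 * K))) :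
    3 * K * Real.log t ≤ Real.log D + 3 * Real.log (3 * K) +
      3 * (((K : ℝ) - 1) / 2 * Real.log c + X / c) + 3 * (Real.log 4 + t * W) := by
  have hK0 : (0 : ℝ) < K := by exact_mod_cast hK
  have hD0 : (0 : ℝ) < D := by exact_mod_cast hD
  have hfac : ((3 * K)! : ℝ) ≤ (3 * (K : ℝ)) ^ (3 * K) := by
    exact_mod_cast Nat.factorial_le_pow (3 * K)
  have hprod := prod_pow_div_factorial_le (K := K) hX hc
  have h' : t ^ (3 * K ^ 2) ≤ (D : ℝ) ^ K * ((3 * (K : ℝ)) ^ (3 * K) *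
      (c ^ (∑ k ∈ Finset.range K, k) * Real.exp (X / c) ^ K) ^ 3 *
        (4 * Real.exp (t * W)) ^ (3 * K)) := by
    refine h.trans ?_
    have : 0 ≤ ∏ i : Fin K × Fin 3, X ^ (i.1 : ℕ) / ((i.1 : ℕ)! : ℝ) :=
      Finset.prod_nonneg fun i _ => by positivity
    gcongr
  have hlog := Real.log_le_log (by positivity) h'
  rw [Real.log_mul (by positivity) (by positivity), Real.log_mul (by positivity) (by positivity),
    Real.log_mul (by positivity) (by positivity)] at hlog
  simp only [Real.log_pow] at hlog
  rw [Real.log_mul (by norm_num : (4 : ℝ) ≠ 0) (Real.exp_pos _).ne',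
    Real.log_mul (pow_pos hc _).ne' (pow_pos (Real.exp_pos _) _).ne'] at hlog
  simp only [Real.log_pow, Real.log_exp] at hlog
  have hsum : ((∑ k ∈ Finset.range K, k : ℕ) : ℝ) = K * ((K : ℝ) - 1) / 2 := by
    have := Finset.sum_range_id_mul_two K
    have h2 : ((∑ k ∈ Finset.range K, k : ℕ) : ℝ) * 2 = K * ((K : ℝ) - 1) := by
      rw [← Nat.cast_pred hK]
      exact_mod_cast this
    linarith
  rw [hsum] at hlog
  push_cast at hlog
  refine le_of_mul_le_mul_left ?_ hK0
  linarith

theorem interpolation_numerics {K Q S X W D L h : ℝ} (hS : 4 ≤ S)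
    (hKS : 1666 * S ≤ K) (hQh : Q * h ≤ K) (hhS : h ≤ S) (hX : X ≤ 12 * K + 11.5 * S)
    (hW : W ≤ 13 * Real.log 2 * (S / 2))
    (hD : D ≤ (3 * Q + 1) * (2 * h) + 4 + S * (13 * Real.log 2))
    (hL : L ≤ 3 * K / 128 - 1 + 7 * Real.log 2) :
    D + 3 * L + 3 * ((K - 1) / 2 * Real.log 32 + X / 32) + 3 * (Real.log 4 + 256 * W) <
      3 * K * Real.log 256 := by
  have hl1 := Real.log_two_gt_d9
  have hl2 := Real.log_two_lt_d9
  rw [show (256 : ℝ) = 2 ^ 8 by norm_num, show (32 : ℝ) = 2 ^ 5 by norm_num,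
    show (4 : ℝ) = 2 ^ 2 by norm_num, Real.log_pow, Real.log_pow, Real.log_pow]
  push_cast
  have hSl : S * Real.log 2 ≤ S * 0.6932 :=
    mul_le_mul_of_nonneg_left (by linarith) (by linarith)
  have hKl : K * 0.6931 ≤ K * Real.log 2 :=
    mul_le_mul_of_nonneg_left (by linarith) (by linarith)
  norm_num at hX ⊢
  nlinarith only [hSl, hKl, hX, hW, hD, hL, hl1, hl2, hS, hKS, hQh, hhS]

theorem pow_mul_two_pow_le_pow {p Q S : ℕ} {v : ℝ} (hv : 0 < v) (hp : 40000 ≤ (p : ℝ))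
    (hQ : 24 * (Q : ℝ) ≤ p) (hS : (S : ℝ) ≤ Real.log v + 1) (hh : 4 ≤ Real.log v) :
    (256 : ℝ) ^ (3 * (Q * S)) * 2 ^ 39 ≤ v ^ p := by
  have hl1 := Real.log_two_gt_d9
  have hl2 := Real.log_two_lt_d9
  rw [← Real.log_le_log_iff (by positivity) (by positivity),
    Real.log_mul (by positivity) (by positivity), Real.log_pow, Real.log_pow, Real.log_pow,
    show (256 : ℝ) = 2 ^ 8 by norm_num, Real.log_pow]
  push_cast
  have h0 : 24 * (Q : ℝ) * S ≤ p * (Real.log v + 1) :=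
    mul_le_mul hQ hS (Nat.cast_nonneg _) (Nat.cast_nonneg _)
  have h2 : 24 * (Q : ℝ) * S * Real.log 2 ≤ p * (Real.log v + 1) * Real.log 2 :=
    mul_le_mul_of_nonneg_right h0 (by linarith)
  have h3 : p * (Real.log v + 1) * Real.log 2 ≤ p * (Real.log v + 1) * 0.6932 :=
    mul_le_mul_of_nonneg_left (by linarith) (mul_nonneg (Nat.cast_nonneg _) (by linarith))
  have h4 : (p : ℝ) * 4 ≤ p * Real.log v := mul_le_mul_of_nonneg_left hh (Nat.cast_nonneg _)
  linarith

/-- Two distinct integers cannot have `p`-th powers whose ratio is too close to the cube of a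
rational number of small height. -/
theorem false_of_pow_eq_cube_mul {u v g₁ g₂ p : ℕ} (hu : 0 < u) (hv : 2 ≤ v) (hg₁ : 0 < g₁)
    (hg₂ : 0 < g₂) (huv : u ≠ v) (hg : g₁ * g₂ ≤ 2 ^ 13) (hp : 40000 ≤ p) {ε : ℝ} (hε : 0 ≤ ε)
    (hεv : ε * (v : ℝ) ^ p ≤ 2 ^ 39)
    (heq : ((u : ℝ) / v) ^ p = ((g₁ : ℝ) / g₂) ^ 3 * (1 + ε)) : False := by
  have hl1 := Real.log_two_gt_d9
  have hl2 := Real.log_two_lt_d9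
  set ℓ := Real.log 2 with hℓ
  have hu0 : (0 : ℝ) < u := by exact_mod_cast hu
  have hv0 : (0 : ℝ) < v := by exact_mod_cast (by omega : 0 < v)
  have hg₁0 : (0 : ℝ) < g₁ := by exact_mod_cast hg₁
  have hg₂0 : (0 : ℝ) < g₂ := by exact_mod_cast hg₂
  have hp' : (40000 : ℝ) ≤ p := by exact_mod_cast hp
  have hG1 : 0 ≤ Real.log g₁ := Real.log_natCast_nonneg _
  have hG2 : 0 ≤ Real.log g₂ := Real.log_natCast_nonneg _
  have hG : Real.log g₁ + Real.log g₂ ≤ 13 * ℓ := by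
    rw [← Real.log_mul hg₁0.ne' hg₂0.ne']
    have h1 : (g₁ : ℝ) * g₂ ≤ 2 ^ 13 := by exact_mod_cast hg
    refine (Real.log_le_log (by positivity) h1).trans_eq ?_
    rw [Real.log_pow]; norm_num [hℓ]
  have hb : |Real.log ((g₁ : ℝ) / g₂)| ≤ 13 * ℓ := by
    rw [Real.log_div hg₁0.ne' hg₂0.ne', abs_le]
    constructor <;> linarith
  have hε1 : ε ≤ 1 := by
    have h1 : (2 : ℝ) ^ 39 ≤ (v : ℝ) ^ p :=
      calc (2 : ℝ) ^ 39 ≤ 2 ^ p := pow_le_pow_right₀ (by norm_num) (by omega)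
        _ ≤ (v : ℝ) ^ p := pow_le_pow_left₀ (by norm_num) (by exact_mod_cast hv) p
    by_contra! h2
    nlinarith [pow_pos hv0 p]
  have hlε0 : 0 ≤ Real.log (1 + ε) := Real.log_nonneg (by linarith)
  have hlε1 : Real.log (1 + ε) ≤ 1 := by
    have := Real.log_le_sub_one_of_pos (show 0 < 1 + ε by linarith)
    linarith
  set h := Real.log v with hh
  have hdiff : p * (Real.log u - h) = 3 * Real.log ((g₁ : ℝ) / g₂) + Real.log (1 + ε) := by
    have h1 := congrArg Real.log heq
    rw [Real.log_pow, Real.log_mul (by positivity) (by positivity), Real.log_pow,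
      Real.log_div hu0.ne' hv0.ne'] at h1
    exact_mod_cast h1
  have hdiff' : p * |Real.log u - h| ≤ 28.04 := by
    rw [← abs_of_nonneg (show (0 : ℝ) ≤ p by linarith), ← abs_mul, hdiff]
    rw [abs_le] at hb ⊢
    constructor <;> linarith
  have hv1024 : (1024 : ℝ) ≤ v := by
    have h1 := inv_add_one_le_abs_log_sub hu (by omega) huv
    have h2 : (p : ℝ) * ((v : ℝ) + 1)⁻¹ ≤ 28.04 :=
      (mul_le_mul_of_nonneg_left h1 (by linarith)).trans hdiff'
    rw [← div_eq_mul_inv, div_le_iff₀ (by positivity)] at h2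
    linarith
  have hh4 : 4 ≤ h := by
    have h1 : Real.log 1024 ≤ h := Real.log_le_log (by norm_num) hv1024
    rw [show (1024 : ℝ) = 2 ^ 10 by norm_num, Real.log_pow] at h1
    norm_num at h1
    linarith
  obtain ⟨Q, hQ1, hQ2, hQ3⟩ : ∃ Q, 24 * Q ≤ p ∧ p ≤ 24 * Q + 23 ∧ 1666 ≤ Q :=
    ⟨p / 24, by omega, by omega, by omega⟩
  obtain ⟨S, hS1, hS2⟩ : ∃ S : ℕ, h ≤ S ∧ (S : ℝ) ≤ h + 1 := by
    refine ⟨⌊h⌋₊ + 1, ?_, ?_⟩ <;> push_cast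
    · exact (Nat.lt_floor_add_one h).le
    · linarith [Nat.floor_le (show 0 ≤ h by linarith)]
  have hS0 : (4 : ℝ) ≤ S := by linarith
  have hSpos : 0 < S := by exact_mod_cast (show (0 : ℝ) < S by linarith)
  obtain ⟨K, hK⟩ : ∃ K, K = Q * S := ⟨_, rfl⟩
  obtain ⟨R, hR⟩ : ∃ R, R = 3 * Q + 2 := ⟨_, rfl⟩
  have hKpos : 0 < K := by rw [hK]; exact Nat.mul_pos (by omega) hSpos
  have hq1 : 24 * (Q : ℝ) ≤ p := by exact_mod_cast hQ1
  have hq2 : (p : ℝ) ≤ 24 * Q + 23 := by exact_mod_cast hQ2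
  have hq3 : (1666 : ℝ) ≤ Q := by exact_mod_cast hQ3
  have hKR : (K : ℝ) = Q * S := by rw [hK]; push_cast; rfl
  have hRR : (R : ℝ) = 3 * Q + 2 := by rw [hR]; push_cast; rfl
  have hR1 : ((R - 1 : ℕ) : ℝ) = 3 * Q + 1 := by
    rw [show R - 1 = 3 * Q + 1 by omega]; push_cast; rfl
  have hS1' : ((S - 1 : ℕ) : ℝ) ≤ S := by exact_mod_cast Nat.sub_le _ _
  set X : ℝ := (3 * ((R : ℝ) - 1) + p * ((S : ℝ) - 1)) / 2 with hX
  have hX0 : 0 ≤ X := by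
    rw [hX, hRR]
    have : 0 ≤ (p : ℝ) * ((S : ℝ) - 1) := mul_nonneg (by linarith) (by linarith)
    linarith
  have hX1 : X ≤ p * S / 2 := by
    rw [hX, hRR]
    linarith
  have hX2 : X ≤ 12 * K + 11.5 * S := by
    rw [hX, hRR, hKR]
    have : (p : ℝ) * ((S : ℝ) - 1) ≤ (24 * Q + 23) * ((S : ℝ) - 1) :=
      mul_le_mul_of_nonneg_right hq2 (by linarith)
    linarith
  have hεt : (256 : ℝ) ^ (3 * K) * ε ≤ 1 := by
    have h1 : (256 : ℝ) ^ (3 * K) * 2 ^ 39 ≤ (v : ℝ) ^ p := by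
      rw [hK]
      exact pow_mul_two_pow_le_pow hv0 hp' hq1 hS2 hh4
    have h2 : ε * ((256 : ℝ) ^ (3 * K) * 2 ^ 39) ≤ 2 ^ 39 :=
      (mul_le_mul_of_nonneg_left h1 hε).trans hεv
    rw [← mul_assoc, mul_comm ε] at h2
    exact (mul_le_iff_le_one_left (by positivity)).1 h2
  have hbasic := pow_le_of_pow_eq_cube_mul (R := R) (S := S) (K := K) hu (by omega) hg₁ hg₂ huv
    (by omega) (by omega) (by rw [hR, hK, Nat.add_sub_cancel, mul_assoc]) hKpos hε
    (by norm_num : (1 : ℝ) ≤ 256) hεt heq hX le_rfl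
  have hfinal := log_le_of_basic_inequality (c := 32) (by positivity) hKpos hX0 (by norm_num)
    (by norm_num) hbasic
  have hWb : |Real.log ((g₁ : ℝ) / g₂) / p| * X ≤ 13 * ℓ * (S / 2) := by
    rw [abs_div, abs_of_nonneg (show (0 : ℝ) ≤ p by linarith), div_mul_eq_mul_div,
      div_le_iff₀ (by linarith)]
    calc |Real.log ((g₁ : ℝ) / g₂)| * X ≤ 13 * ℓ * (p * S / 2) := by gcongr
      _ = _ := by ring
  have hD : Real.log ((u ^ (R - 1) * g₁ ^ (S - 1) * (v ^ (R - 1) * g₂ ^ (S - 1)) : ℕ) : ℝ) ≤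
      (3 * Q + 1) * (2 * h) + 4 + S * (13 * ℓ) := by
    push_cast
    rw [Real.log_mul (by positivity) (by positivity), Real.log_mul (by positivity) (by positivity),
      Real.log_mul (by positivity) (by positivity)]
    simp only [Real.log_pow]
    rw [hR1]
    have h1 : ((S - 1 : ℕ) : ℝ) * (Real.log g₁ + Real.log g₂) ≤ S * (13 * ℓ) := by gcongr
    have h2 : (3 * (Q : ℝ) + 1) * (Real.log u - h) ≤ 4 := by
      refine (mul_le_mul_of_nonneg_left (le_abs_self _) (by linarith)).trans ?_
      have h3 : 3 * (Q : ℝ) + 1 ≤ p * (1 / 7.5) := by linarith only [hq1, hp']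
      have h4 := mul_le_mul_of_nonneg_right h3 (abs_nonneg (Real.log u - h))
      linarith only [h4, hdiff']
    linarith
  have hlog3K : Real.log (3 * K) ≤ 3 * K / 128 - 1 + 7 * ℓ := by
    have hK0 : (0 : ℝ) < K := by exact_mod_cast hKpos
    have h1 := Real.log_le_sub_one_of_pos (show (0 : ℝ) < 3 * K / 128 by positivity)
    rw [Real.log_div (by positivity) (by norm_num), show (128 : ℝ) = 2 ^ 7 by norm_num,
      Real.log_pow] at h1
    norm_num at h1
    linarith
  have hKS : 1666 * (S : ℝ) ≤ K := by rw [hKR]; gcongr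
  have hQh : (Q : ℝ) * h ≤ K := by rw [hKR]; gcongr
  exact hfinal.not_gt (interpolation_numerics hS0 hKS hQh hS1 hX2 hWb hD hlog3K)

/-- `Y * (Y ^ 2 + N)` is not a high power when `N` is small. -/
theorem mul_sq_add_ne_pow {Y N w p : ℕ} (hY : 0 < Y) (hN : 0 < N) (hN' : N ≤ 2 ^ 13) (hw : 2 ≤ w)
    (hp : 40000 ≤ p) : Y * (Y ^ 2 + N) ≠ w ^ p := by
  intro h
  obtain ⟨g₁, g₂, z₁, z₂, hg₁, hg₂, hg, h1, h2⟩ := exists_pow_split hY hN h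
  have hg₁N : g₁ ≤ N := (Nat.le_mul_of_pos_right _ hg₂).trans hg
  have hg₂N : g₂ ≤ N := (Nat.le_mul_of_pos_left _ hg₁).trans hg
  have hz₁ : 2 ≤ z₁ := by
    by_contra! hlt
    have h3 : z₁ ^ p ≤ 1 := pow_le_one₀ (Nat.zero_le _) (by omega)
    have h4 : Y ≤ N :=
      calc Y ≤ Y * g₂ := Nat.le_mul_of_pos_right _ hg₂
        _ = g₁ * z₁ ^ p := h1
        _ ≤ N * 1 := Nat.mul_le_mul hg₁N h3
        _ = N := mul_one _
    have h5 : Y * (Y ^ 2 + N) ≤ 2 ^ 13 * ((2 ^ 13) ^ 2 + 2 ^ 13) := by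
      have := h4.trans hN'
      gcongr
    have h6 : 2 ^ 40 ≤ w ^ p :=
      (Nat.pow_le_pow_right (by norm_num) (by omega)).trans (Nat.pow_le_pow_left hw p)
    rw [h] at h5
    norm_num at h5 h6
    omega
  have hz₂ : 0 < z₂ := by
    rcases Nat.eq_zero_or_pos z₂ with h3 | h3
    · rw [h3, zero_pow (by omega), mul_zero] at h2
      have : 0 < (Y ^ 2 + N) * g₁ := by positivity
      omega
    · exact h3
  have hYR : (0 : ℝ) < Y := by exact_mod_cast hY
  have hg₁R : (0 : ℝ) < g₁ := by exact_mod_cast hg₁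
  have hg₂R : (0 : ℝ) < g₂ := by exact_mod_cast hg₂
  have hz₁R : (0 : ℝ) < z₁ := by exact_mod_cast (by omega : 0 < z₁)
  have hNR : (N : ℝ) ≤ 2 ^ 13 := by exact_mod_cast hN'
  have hg₂NR : (g₂ : ℝ) ≤ 2 ^ 13 := by exact_mod_cast hg₂N.trans hN'
  have hg₁1 : (1 : ℝ) ≤ g₁ := by exact_mod_cast hg₁
  have h1R : (z₁ : ℝ) ^ p = Y * g₂ / g₁ := by
    rw [eq_div_iff hg₁R.ne']
    exact_mod_cast (by rw [h1, mul_comm] : z₁ ^ p * g₁ = Y * g₂)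
  have h2R : (z₂ : ℝ) ^ p = ((Y : ℝ) ^ 2 + N) * g₁ / g₂ := by
    rw [eq_div_iff hg₂R.ne']
    exact_mod_cast (by rw [h2, mul_comm] : z₂ ^ p * g₂ = (Y ^ 2 + N) * g₁)
  have hvp : (((z₁ ^ 2 : ℕ) : ℝ)) ^ p = ((Y : ℝ) * g₂ / g₁) ^ 2 := by
    push_cast
    rw [← pow_mul, mul_comm, pow_mul, h1R]
  set ε : ℝ := N / (Y : ℝ) ^ 2 with hε
  have hεv : ε * (((z₁ ^ 2 : ℕ) : ℝ)) ^ p ≤ 2 ^ 39 := by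
    rw [hvp, hε]
    calc (N : ℝ) / (Y : ℝ) ^ 2 * ((Y : ℝ) * g₂ / g₁) ^ 2 = N * (g₂ ^ 2 / g₁ ^ 2) := by field_simp
      _ ≤ 2 ^ 13 * ((2 ^ 13) ^ 2 / 1 ^ 2) := by gcongr
      _ = 2 ^ 39 := by norm_num
  have heq : ((z₂ : ℝ) / ((z₁ ^ 2 : ℕ) : ℝ)) ^ p = ((g₁ : ℝ) / g₂) ^ 3 * (1 + ε) := by
    rw [div_pow, hvp, h2R, hε]
    field_simp
  have hv : 2 ≤ z₁ ^ 2 := by nlinarith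
  have hne : z₂ ≠ z₁ ^ 2 := by
    intro huv
    rw [← huv, div_self (by positivity), one_pow] at heq
    have h3 : (g₂ : ℝ) ^ 3 = g₁ ^ 3 * (1 + ε) := by
      rw [div_pow] at heq
      field_simp at heq
      linarith
    have hε0 : 0 < ε := by
      rw [hε]
      have : (0 : ℝ) < N := by exact_mod_cast hN
      positivity
    have h4 : (g₁ : ℝ) ^ 3 + 1 ≤ g₂ ^ 3 := by
      have : (g₁ : ℝ) ^ 3 < g₂ ^ 3 := by
        rw [h3]
        have := pow_pos hg₁R 3
        nlinarith
      have h5 : g₁ ^ 3 < g₂ ^ 3 := by exact_mod_cast this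
      exact_mod_cast h5
    have h5 : (1 : ℝ) ≤ (2 ^ 13) ^ 3 * ε :=
      calc (1 : ℝ) ≤ (g₁ : ℝ) ^ 3 * ε := by linarith
        _ ≤ (2 ^ 13) ^ 3 * ε := by
          have : (g₁ : ℝ) ≤ 2 ^ 13 := by exact_mod_cast hg₁N.trans hN'
          gcongr
    have h6 : (2 : ℝ) ^ 79 ≤ ((z₁ ^ 2 : ℕ) : ℝ) ^ p :=
      (pow_le_pow_right₀ (by norm_num) (by omega)).trans
        (pow_le_pow_left₀ (by norm_num) (by exact_mod_cast hv) p)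
    have h7 : ε * 2 ^ 79 ≤ 2 ^ 39 := (mul_le_mul_of_nonneg_left h6 hε0.le).trans hεv
    norm_num at h5 h7
    linarith
  exact false_of_pow_eq_cube_mul hz₂ hv hg₁ hg₂ hne (hg.trans hN') hp (by positivity) hεv heq

/-- Let `1 ≤ d ≤ 50`, `p` prime, `(α, β) ∈ S_d`, and `z₁, z₂` integers with
`|z₁| ≥ 2`, `z₂ ≥ 2`, `z₁² ≠ z₂` and `β·z₂^p − α²·z₁^{2p} = 3d(d+1)`.  Then
`p < 4·10⁴`. -/
theorem exponent_bound (d : ℕ) (hd1 : 1 ≤ d) (hd2 : d ≤ 50)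
    (p : ℕ) (hp : p.Prime)
    (α β : ℚ) (hS : memSd d α β) (z₁ z₂ : ℤ) (hz1 : 2 ≤ |z₁|) (hz2 : 2 ≤ z₂)
    (hne : z₁ ^ 2 ≠ z₂)
    (heq : β * (z₂ : ℚ) ^ p - α ^ 2 * (z₁ : ℚ) ^ (2 * p) = 3 * d * (d + 1)) :
    p < 4 * 10 ^ 4 := by
  by_contra! hp4
  obtain ⟨hα, hβ, hαβ, -⟩ := hS
  have hz₁2 : 2 ≤ z₁.natAbs := by
    rw [Int.abs_eq_natAbs] at hz1
    exact_mod_cast hz1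
  have hz₁0 : (0 : ℚ) < ((z₁.natAbs : ℕ) : ℚ) := by
    exact_mod_cast (by omega : 0 < z₁.natAbs)
  have hz₂cast : ((z₂.natAbs : ℕ) : ℚ) = z₂ := by
    rw [Nat.cast_natAbs, abs_of_nonneg (by omega)]
  have hz₁cast : ((z₁.natAbs : ℕ) : ℚ) ^ 2 = (z₁ : ℚ) ^ 2 := by
    rw [Nat.cast_natAbs]; push_cast; exact sq_abs _
  have hr : α * ((z₁.natAbs : ℕ) : ℚ) ^ p *
      ((α * ((z₁.natAbs : ℕ) : ℚ) ^ p) ^ 2 + ((3 * d * (d + 1) : ℕ) : ℚ)) =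
      (((z₁.natAbs * z₂.natAbs) ^ p : ℕ) : ℚ) := by
    have h1 : (α * ((z₁.natAbs : ℕ) : ℚ) ^ p) ^ 2 = α ^ 2 * (z₁ : ℚ) ^ (2 * p) := by
      rw [mul_pow, ← pow_mul, mul_comm p 2, pow_mul, hz₁cast, ← pow_mul]
    rw [h1]
    push_cast
    rw [← heq, mul_pow, hz₂cast]
    linear_combination ((z₁.natAbs : ℕ) : ℚ) ^ p * (z₂ : ℚ) ^ p * hαβ
  obtain ⟨Y, hY⟩ := exists_nat_eq_of_mul_sq_add (by positivity) hr
  rw [hY] at hr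
  have hY0 : 0 < Y := by
    have : (0 : ℚ) < Y := by rw [← hY]; positivity
    exact_mod_cast this
  refine mul_sq_add_ne_pow (N := 3 * d * (d + 1)) (w := z₁.natAbs * z₂.natAbs) hY0 (by positivity)
    ?_ ?_ (by omega) (by exact_mod_cast hr)
  · nlinarith
  · have h2 : 2 ≤ z₂.natAbs := by omega
    nlinarith
end

section
/- Let p ≥ 3 be a prime and let r, s, t be positive integers with gcd(r, s, t) = 1. Let q = 2kp + 1 be a prime (k a positive integer) that does not divide r. Define μ(p,q) = {η^{2p} : η ∈ F_q} (equivalently, {0} ∪ {ζ ∈ F_q* : ζ^k = 1}) and B(p,q) = {ζ ∈ μ(p,q) : ((sζ + t)/r)^{2k} ∈ {0, 1}} (where division by r is in F_q). If B(p,q) = ∅, then there are no integers z₁, z₂ with r·z₂^p − s·z₁^{2p} = t. -/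
/-- Variation of Kraus's criterion.  Let `p ≥ 3` be prime, `r, s, t` positive integers
with `gcd(r,s,t) = 1`, and let `q = 2kp + 1` be a prime not dividing `r`.  If no
`ζ ∈ μ(p,q) = {η^{2p} : η ∈ F_q}` satisfies `((sζ + t)/r)^{2k} ∈ {0, 1}`, then the
equation `r·z₂^p − s·z₁^{2p} = t` has no integral solutions. -/
theorem kraus_criterion (p : ℕ) (hp : p.Prime) (hp3 : 3 ≤ p)
    (r s t : ℕ) (hr : 0 < r) (hs : 0 < s) (ht : 0 < t)
    (hgcd : Nat.gcd r (Nat.gcd s t) = 1)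
    (k : ℕ) (hk : 0 < k) (q : ℕ) (hq : q = 2 * k * p + 1) (hqp : q.Prime)
    (hqr : ¬ (q ∣ r))
    (hB : ∀ ζ : ZMod q, (∃ η : ZMod q, η ^ (2 * p) = ζ) →
      ¬ ((((s : ZMod q) * ζ + (t : ZMod q)) * (r : ZMod q)⁻¹) ^ (2 * k) = 0 ∨
         (((s : ZMod q) * ζ + (t : ZMod q)) * (r : ZMod q)⁻¹) ^ (2 * k) = 1)) :
    ¬ ∃ z₁ z₂ : ℤ, (r : ℤ) * z₂ ^ p - (s : ℤ) * z₁ ^ (2 * p) = (t : ℤ) := by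
  rintro ⟨z₁, z₂, h⟩
  have : Fact q.Prime := ⟨hqp⟩
  have hr0 : (r : ZMod q) ≠ 0 := fun h0 => hqr ((ZMod.natCast_eq_zero_iff r q).1 h0)
  have hmod := congrArg (Int.cast : ℤ → ZMod q) h
  push_cast at hmod
  have hz : ((s : ZMod q) * (z₁ : ZMod q) ^ (2 * p) + (t : ZMod q)) * (r : ZMod q)⁻¹
      = (z₂ : ZMod q) ^ p := by
    rw [mul_inv_eq_iff_eq_mul₀ hr0, ← hmod]
    ring
  refine hB ((z₁ : ZMod q) ^ (2 * p)) ⟨z₁, rfl⟩ ?_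
  have hexp : p * (2 * k) = q - 1 := by
    rw [hq, Nat.add_sub_cancel, mul_comm]
  rw [hz, ← pow_mul, hexp]
  by_cases h0 : (z₂ : ZMod q) = 0
  · exact Or.inl (by rw [h0, zero_pow (Nat.sub_pos_of_lt hqp.one_lt).ne'])
  · exact Or.inr (ZMod.pow_card_sub_one_eq_one h0)
end

section
/- Let p be an odd prime, m a positive squarefree integer, K = Q(√−m) with ring of integers O, v, n nonzero integers and ε ∈ O nonzero. Let q = 2kp + 1 be a rational prime (k a positive integer) such that qO = 𝔮₁𝔮₂ with 𝔮₁, 𝔮₂ distinct prime ideals of O and ord_{𝔮_j}(ε) = 0 for j = 1, 2. Let χ(p,q) = {η^p : η ∈ F_q} and C(p,q) = {ζ ∈ χ(p,q) : ((v·ζ + n√−m)/ε)^{2k} ≡ 0 or 1 (mod 𝔮_j) for j = 1, 2}. If C(p,q) = ∅, then there are no X ∈ Z and Z ∈ K* satisfying v·X^p + n·√−m = ε·Z^p. -/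
open IsDedekindDomain NumberField

set_option synthInstance.maxHeartbeats 400000

/-- If the residue field of `I` has `2 * k * p + 1` elements, `ε` is a unit modulo `I` and
`w ^ p = ε ^ (p - 1) * A`, then the `2k`-th power of `A / ε` is `0` or `1`. -/
theorem exists_quotient_pow_eq_zero_or_one {R : Type*} [CommRing R] (I : Ideal R) [I.IsMaximal]
    {p k : ℕ} (hp : 0 < p) (hk : 0 < k) (hcard : Nat.card (R ⧸ I) = 2 * k * p + 1)
    {ε w A : R} (hε : ε ∉ I) (hw : w ^ p = ε ^ (p - 1) * A) :
    ∃ c : R ⧸ I, c * Ideal.Quotient.mk I ε = Ideal.Quotient.mk I A ∧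
      (c ^ (2 * k) = 0 ∨ c ^ (2 * k) = 1) := by
  let _ : Field (R ⧸ I) := Ideal.Quotient.field I
  have : Finite (R ⧸ I) := Nat.finite_of_card_ne_zero (by omega)
  let _ := Fintype.ofFinite (R ⧸ I)
  have hε' : Ideal.Quotient.mk I ε ≠ 0 := by rwa [Ne, Ideal.Quotient.eq_zero_iff_mem]
  have hw' : Ideal.Quotient.mk I w ^ p =
      Ideal.Quotient.mk I ε ^ (p - 1) * Ideal.Quotient.mk I A := by
    rw [← map_pow, hw, map_mul, map_pow]
  obtain ⟨r, rfl⟩ : ∃ r, p = r + 1 := ⟨p - 1, by omega⟩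
  refine ⟨(Ideal.Quotient.mk I w / Ideal.Quotient.mk I ε) ^ (r + 1), ?_, ?_⟩
  · rw [div_pow, hw']
    simp only [Nat.add_sub_cancel]
    field_simp
    ring
  · rw [← pow_mul]
    rcases eq_or_ne (Ideal.Quotient.mk I w / Ideal.Quotient.mk I ε) 0 with h | h
    · left
      rw [h, zero_pow (by positivity)]
    · right
      have := FiniteField.pow_card_sub_one_eq_one _ h
      rwa [← Nat.card_eq_fintype_card, hcard, Nat.add_sub_cancel, mul_comm] at this

/-- A rational prime which is a product of two primes in a quadratic field has both residue fields
of prime order. -/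
theorem card_quotient_eq_of_span_eq_mul {K : Type*} [Field K] [NumberField K]
    (hdeg : Module.finrank ℚ K = 2) {q : ℕ} (hq : q.Prime)
    (P Q : HeightOneSpectrum (RingOfIntegers K))
    (hsplit : Ideal.span {(q : RingOfIntegers K)} = P.asIdeal * Q.asIdeal) :
    Nat.card (RingOfIntegers K ⧸ P.asIdeal) = q ∧
      Nat.card (RingOfIntegers K ⧸ Q.asIdeal) = q := by
  have h := congrArg Ideal.absNorm hsplit
  rw [Ideal.absNorm_span_natCast, RingOfIntegers.rank, hdeg, map_mul, eq_comm,
    hq.mul_eq_prime_sq_iff (by simpa [Ideal.absNorm_eq_one_iff] using P.isPrime.ne_top)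
      (by simpa [Ideal.absNorm_eq_one_iff] using Q.isPrime.ne_top)] at h
  exact h

/-- Descent criterion (Lemma 9.2 of Bennett–Patel–Siksek).  Let `p` be an odd prime,
`m` a positive squarefree integer, `K = ℚ(√−m)` with ring of integers `O`, `v, n`
nonzero integers and `ε ∈ O` nonzero.  Let `q = 2kp + 1` be a rational prime with
`qO = 𝔮₁𝔮₂` for distinct primes `𝔮₁ ≠ 𝔮₂` at which `ε` is a unit.  If no `p`-th power
residue `ζ ∈ F_q` satisfies `((v·ζ + n√−m)/ε)^{2k} ≡ 0` or `1 (mod 𝔮_j)` for `j = 1, 2`,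
then `v·X^p + n·√−m = ε·Z^p` has no solutions `X ∈ ℤ`, `Z ∈ K*`. -/
theorem descent_split_prime_criterion (p : ℕ) (hp : p.Prime) (hodd : Odd p)
    (m : ℕ) (hm : 0 < m) (hsf : Squarefree m)
    (K : Type) [Field K] [NumberField K] (hdeg : Module.finrank ℚ K = 2)
    (sqm : RingOfIntegers K) (hsqm : sqm ^ 2 = -(m : RingOfIntegers K))
    (v n : ℤ) (hv : v ≠ 0) (hn : n ≠ 0) (ε : RingOfIntegers K) (hε : ε ≠ 0)
    (k : ℕ) (hk : 0 < k) (q : ℕ) (hq : q = 2 * k * p + 1) (hqp : q.Prime)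
    (𝔮₁ 𝔮₂ : HeightOneSpectrum (RingOfIntegers K)) (hne : 𝔮₁ ≠ 𝔮₂)
    (hsplit : Ideal.span {(q : RingOfIntegers K)} = 𝔮₁.asIdeal * 𝔮₂.asIdeal)
    (hε₁ : ε ∉ 𝔮₁.asIdeal) (hε₂ : ε ∉ 𝔮₂.asIdeal)
    (hC : ∀ a : ℤ, (∃ η : ℤ, (a : ZMod q) = (η : ZMod q) ^ p) →
      ¬ ((∃ c : RingOfIntegers K ⧸ 𝔮₁.asIdeal,
            c * Ideal.Quotient.mk 𝔮₁.asIdeal ε =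
              Ideal.Quotient.mk 𝔮₁.asIdeal ((v : RingOfIntegers K) * a + n * sqm) ∧
            (c ^ (2 * k) = 0 ∨ c ^ (2 * k) = 1)) ∧
         (∃ c : RingOfIntegers K ⧸ 𝔮₂.asIdeal,
            c * Ideal.Quotient.mk 𝔮₂.asIdeal ε =
              Ideal.Quotient.mk 𝔮₂.asIdeal ((v : RingOfIntegers K) * a + n * sqm) ∧
            (c ^ (2 * k) = 0 ∨ c ^ (2 * k) = 1)))) :
    ¬ ∃ (X : ℤ) (Z : K), Z ≠ 0 ∧
      (v : K) * (X : K) ^ p + (n : K) * (sqm : K) = (ε : K) * Z ^ p := by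
  rintro ⟨X, Z, -, hZ⟩
  have hp0 := hp.pos
  obtain ⟨hc₁, hc₂⟩ := card_quotient_eq_of_span_eq_mul hdeg hqp 𝔮₁ 𝔮₂ hsplit
  rw [hq] at hc₁ hc₂
  set A : RingOfIntegers K := (v : RingOfIntegers K) * ((X ^ p : ℤ) : RingOfIntegers K) + n * sqm
    with hA
  have hA' : algebraMap (RingOfIntegers K) K A = algebraMap (RingOfIntegers K) K ε * Z ^ p := by
    rw [← hZ, hA]
    simp
  have hpow : (algebraMap (RingOfIntegers K) K ε * Z) ^ p =
      algebraMap (RingOfIntegers K) K (ε ^ (p - 1) * A) := by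
    rw [map_mul, map_pow, hA', mul_pow, ← mul_assoc, pow_sub_one_mul hp0.ne']
  obtain ⟨w, hw⟩ : ∃ w : RingOfIntegers K, algebraMap (RingOfIntegers K) K w = algebraMap (RingOfIntegers K) K ε * Z :=
    IsIntegrallyClosed.exists_algebraMap_eq_of_isIntegral_pow hp0
      (hpow ▸ isIntegral_algebraMap)
  have hwp : w ^ p = ε ^ (p - 1) * A := by
    apply RingOfIntegers.coe_injective
    rw [← hpow, map_pow, hw]
  have := 𝔮₁.isMaximal
  have := 𝔮₂.isMaximal
  exact hC (X ^ p) ⟨X, by push_cast; rfl⟩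
    ⟨exists_quotient_pow_eq_zero_or_one _ hp0 hk hc₁ hε₁ hwp,
      exists_quotient_pow_eq_zero_or_one _ hp0 hk hc₂ hε₂ hwp⟩
end

section
/- Let d be an integer with 1 ≤ d ≤ 50 and let x, z be integers satisfying ∑_{i=1}^{2d+1} (−1)^{i−1} (x+i)³ = z³. Then either (x, z) = (−d−1, 0), or (d, x, z) is one of: (26, −39, −30), (26, −36, −27), (26, −18, 27), (26, −15, 30), (27, −46, −36), (27, −34, −24), (27, −22, 24), (27, −10, 36), (36, −91, −72), (36, −39, −20), (36, −35, 20), (36, 17, 72), (42, −124, −99), (42, 38, 99), (49, −95, −75), (49, −5, 75). Conversely, each of these triples is a solution. -/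
/-- The alternating sum `(x+1)³ − (x+2)³ + ⋯ + (x+2d+1)³` of `2d+1` consecutive cubes. -/
def altCubeSum (d : ℕ) (x : ℤ) : ℤ :=
  ∑ i ∈ Finset.range (2 * d + 1), (-1 : ℤ) ^ i * (x + (i : ℤ) + 1) ^ 3

/-- The nontrivial solutions `(d, x, z)` of `altCubeSum d x = z³` for `1 ≤ d ≤ 50`. -/
def cubeSolList : List (ℕ × ℤ × ℤ) :=
  [(26, -39, -30), (26, -36, -27), (26, -18, 27), (26, -15, 30),
   (27, -46, -36), (27, -34, -24), (27, -22, 24), (27, -10, 36),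
   (36, -91, -72), (36, -39, -20), (36, -35, 20), (36, 17, 72),
   (42, -124, -99), (42, 38, 99), (49, -95, -75), (49, -5, 75)]

theorem altCubeSum_eq (d : ℕ) (x : ℤ) :
    altCubeSum d x = (x + d + 1) ^ 3 + 3 * (d * (d + 1)) * (x + d + 1) := by
  unfold altCubeSum
  induction d with
  | zero => simp
  | succ d ih =>
    rw [show 2 * (d + 1) + 1 = 2 * d + 1 + 1 + 1 by ring, Finset.sum_range_succ,
      Finset.sum_range_succ, ih, pow_succ _ (2 * d + 1), pow_succ _ (2 * d), pow_mul]
    push_cast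
    ring

theorem mem_cubeSolList_of_mul_eq :
    ∀ u ∈ Finset.Ico 1 12, ∀ y ∈ Finset.Ico 1 851, y ∣ 9 * u ^ 3 → ∀ d ∈ Finset.range 51,
      d * (d + 1) * y = 3 * u * y ^ 2 + 9 * u ^ 2 * y + 9 * u ^ 3 →
        (d, (y : ℤ) - d - 1, (y : ℤ) + 3 * u) ∈ cubeSolList ∧
        (d, -(y : ℤ) - d - 1, -((y : ℤ) + 3 * u)) ∈ cubeSolList := by
  decide +kernel

/-- Integral points with positive first coordinate on `y³ + 3d(d+1)y = z³`. -/
theorem mem_cubeSolList_of_pos {d : ℕ} (hd : 1 ≤ d) (hd' : d ≤ 50) {y z : ℤ} (hy : 0 < y)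
    (h : y ^ 3 + 3 * (d * (d + 1)) * y = z ^ 3) :
    (d, y - d - 1, z) ∈ cubeSolList ∧ (d, -y - d - 1, -z) ∈ cubeSolList := by
  have hd0 : (1 : ℤ) ≤ d := by exact_mod_cast hd
  have hd1 : (d : ℤ) ≤ 50 := by exact_mod_cast hd'
  obtain ⟨m, hm⟩ : ∃ m : ℤ, m = d * (d + 1) := ⟨_, rfl⟩
  have hm0 : 0 < m := by rw [hm]; positivity
  have hm1 : m ≤ 2550 := by rw [hm]; nlinarith
  rw [← hm] at h
  have hyz : y < z := by
    refine lt_of_pow_lt_pow_left₀ 3 ?_ ?_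
    · by_contra! hz
      have : z ^ 3 < 0 := Odd.pow_neg (by decide) hz
      have : 0 < y ^ 3 + 3 * m * y := by positivity
      linarith
    · have : 0 < 3 * m * y := by positivity
      linarith
  obtain ⟨t, rfl⟩ : ∃ t, z = y + t := ⟨z - y, by ring⟩
  have ht3 : (3 : ℤ) ∣ t :=
    Int.prime_three.dvd_of_dvd_pow (n := 3)
      ⟨m * y - y ^ 2 * t - y * t ^ 2, by linear_combination -h⟩
  obtain ⟨u, rfl⟩ := ht3
  have hu : 0 < u := by linarith
  have heq : m * y = 3 * u * y ^ 2 + 9 * u ^ 2 * y + 9 * u ^ 3 := by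
    linarith [show 3 * (m * y) = 3 * (3 * u * y ^ 2 + 9 * u ^ 2 * y + 9 * u ^ 3) by
      linear_combination h]
  have hu3 : 0 < u ^ 3 := by positivity
  have hu2 : 0 < u ^ 2 := by positivity
  have hy1 : 3 * u * y < m := by
    refine lt_of_mul_lt_mul_right (a := y) ?_ hy.le
    have : 0 < u ^ 2 * y := by positivity
    linarith [show 3 * u * y * y = 3 * u * y ^ 2 by ring]
  have hu1 : 19 * u ^ 2 ≤ m := by
    refine le_of_mul_le_mul_right (a := y) ?_ hy
    have : 0 ≤ u * (3 * y ^ 2 - 10 * u * y + 9 * u ^ 2) :=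
      mul_nonneg hu.le (by nlinarith [sq_nonneg (3 * y - 5 * u)])
    linarith [show u * (3 * y ^ 2 - 10 * u * y + 9 * u ^ 2) =
      3 * u * y ^ 2 - 10 * (u ^ 2 * y) + 9 * u ^ 3 by ring]
  have hu12 : u < 12 := by nlinarith
  have hy851 : y < 851 := by nlinarith
  have hdvd : y ∣ 9 * u ^ 3 :=
    ⟨m - 3 * u * y - 9 * u ^ 2, by linear_combination -heq⟩
  lift u to ℕ using hu.le
  lift y to ℕ using hy.le
  rw [hm] at heq
  exact mem_cubeSolList_of_mul_eq u (Finset.mem_Ico.2 (by omega)) y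
    (Finset.mem_Ico.2 (by omega)) (by exact_mod_cast hdvd) d (Finset.mem_range.2 (by omega))
    (by exact_mod_cast heq)

/-- For `1 ≤ d ≤ 50`, the only integer solutions of
`∑_{i=1}^{2d+1} (−1)^{i−1}(x+i)³ = z³` are `(x, z) = (−d−1, 0)` together with the
sixteen triples of `cubeSolList`; conversely each listed triple is a solution. -/
theorem alternating_cubes_p_eq_three :
    (∀ d : ℕ, 1 ≤ d → d ≤ 50 → ∀ x z : ℤ,
      altCubeSum d x = z ^ 3 →
        (x = -((d : ℤ) + 1) ∧ z = 0) ∨ (d, x, z) ∈ cubeSolList) ∧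
    (∀ t ∈ cubeSolList, altCubeSum t.1 t.2.1 = t.2.2 ^ 3) := by
  refine ⟨fun d hd hd' x z h => ?_, fun t ht => ?_⟩
  · rw [altCubeSum_eq] at h
    obtain ⟨y, hy⟩ : ∃ y, y = x + d + 1 := ⟨_, rfl⟩
    rw [← hy] at h
    rcases lt_trichotomy y 0 with hneg | rfl | hpos
    · have := (mem_cubeSolList_of_pos hd hd' (neg_pos.2 hneg) (z := -z)
        (by linear_combination -h)).2
      rw [neg_neg, neg_neg, show y - d - 1 = x by linarith] at this
      exact Or.inr this
    · refine Or.inl ⟨by linarith, ?_⟩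
      exact pow_eq_zero_iff (n := 3) (by norm_num) |>.1 (by linarith)
    · have := (mem_cubeSolList_of_pos hd hd' hpos h).1
      rw [show y - d - 1 = x by linarith] at this
      exact Or.inr this
  · revert t
    simp only [altCubeSum_eq]
    decide +kernel
end
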